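/- Fix an entire function F : ℂ → ℂ that does not vanish on ℂ \ {0}, a function W : (0,∞) → ℝ with W(w) − w = O(w²) as w → 0⁺, and τ ∈ ℂ; set z(w) = (1 − τ·w^{2/3})/(e·w). Then, as w → 0⁺, φ_1(z(w), w, W(w); F) = −√(2π) · 2^{2/3} · w^{1/6} · K_1(τ, w) · exp(−1/(2w) + τ/w^{1/3}), where K_1(τ, w) = F(1)·Ai'(2^{1/3}τ) + w^{1/3}·( (1/3)·(F(1) + 6·F'(1))·2^{−1/3}·τ·Ai(2^{1/3}τ) + (5/6)·F(1)·τ²·Ai'(2^{1/3}τ) ) + O(w^{2/3}). -/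

import Mathlib

open Filter Topology

/-- The contour `Π(π/3)`. -/
noncomputable def airyPath (φ : ℝ) (s : ℝ) : ℂ :=
  if s ≤ -1 then -Complex.exp (-(φ : ℂ) * Complex.I) * (s : ℂ)
  else if s ≤ 1 then (Real.cos φ : ℂ) + Complex.I * (s : ℂ) * (Real.sin φ : ℂ)
  else Complex.exp ((φ : ℂ) * Complex.I) * (s : ℂ)

/-- The piecewise derivative of the contour `Π(φ)`. -/
noncomputable def airyPathDeriv (φ : ℝ) (s : ℝ) : ℂ :=
  if s ≤ -1 then -Complex.exp (-(φ : ℂ) * Complex.I)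
  else if s ≤ 1 then Complex.I * (Real.sin φ : ℂ)
  else Complex.exp ((φ : ℂ) * Complex.I)

/-- The Airy function `Ai(z) = (1/(2πi)) ∫_{Π(π/3)} e^{−zt + t³/3} dt`. -/
noncomputable def airyAi (z : ℂ) : ℂ :=
  (1 / (2 * (Real.pi : ℂ) * Complex.I)) *
    ∫ s : ℝ, Complex.exp (-z * airyPath (Real.pi / 3) s + (airyPath (Real.pi / 3) s) ^ 3 / 3) *
      airyPathDeriv (Real.pi / 3) s

/-- The derivative `Ai'` of the Airy function. -/
noncomputable def airyAi' (z : ℂ) : ℂ := deriv airyAi z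

/-- `φ_r(z, w, w⁺; F)`. -/
noncomputable def phiR (r : ℤ) (z : ℂ) (w wp : ℝ) (F : ℂ → ℂ) : ℂ :=
  (1 / (Real.sqrt (2 * Real.pi * w) : ℂ)) *
    ∫ x : ℝ, (1 - z * (wp : ℂ) * Complex.exp (-Complex.I * (x : ℂ))) ^ r *
      Complex.exp (-(x : ℂ) ^ 2 / (2 * (w : ℂ)) - z * Complex.exp (-Complex.I * (x : ℂ))) *
      F (z * (wp : ℂ) * Complex.exp (-Complex.I * (x : ℂ)))

open MeasureTheory

/-- Taylor bound for the exponential whose constant only involves the real part. -/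
lemma norm_exp_sub_sum_le_max (n : ℕ) (z : ℂ) :
    ‖Complex.exp z - ∑ k ∈ Finset.range n, z ^ k / (k.factorial : ℂ)‖ ≤
      ‖z‖ ^ n / n.factorial * max 1 (Real.exp z.re) := by
  induction n generalizing z with
  | zero => simp [Complex.norm_exp]
  | succ n ih =>
    set M := max 1 (Real.exp z.re) with hM
    have hsum : ∀ x : ℂ, HasDerivAt
        (fun y : ℂ => Complex.exp y - ∑ k ∈ Finset.range (n + 1), y ^ k / (k.factorial : ℂ))
        (Complex.exp x - ∑ k ∈ Finset.range n, x ^ k / (k.factorial : ℂ)) x := by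
      intro x
      refine (Complex.hasDerivAt_exp x).sub ?_
      simp_rw [Finset.sum_range_succ' _ n]
      have := HasDerivAt.fun_sum (u := Finset.range n) (x := x)
        (A := fun k (y : ℂ) => y ^ (k + 1) / ((k + 1).factorial : ℂ))
        (A' := fun k => x ^ k / (k.factorial : ℂ)) (fun k _ => by
          have h := (hasDerivAt_pow (k + 1) x).div_const ((k + 1).factorial : ℂ)
          refine h.congr_deriv ?_
          rw [Nat.factorial_succ]
          have : (k.factorial : ℂ) ≠ 0 := by exact_mod_cast k.factorial_ne_zero
          have : (k + 1 : ℂ) ≠ 0 := by exact_mod_cast k.succ_ne_zero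
          push_cast
          field_simp)
      simpa using this
    have hd : ∀ t : ℝ, HasDerivAt
        (fun t : ℝ => Complex.exp (t * z) -
          ∑ k ∈ Finset.range (n + 1), (t * z) ^ k / (k.factorial : ℂ))
        ((Complex.exp (t * z) - ∑ k ∈ Finset.range n, (t * z) ^ k / (k.factorial : ℂ)) * z) t := by
      intro t
      have h1 : HasDerivAt (fun t : ℝ => (t : ℂ) * z) z t := by
        simpa using (Complex.ofRealCLM.hasDerivAt (x := t)).mul_const z
      exact (hsum (t * z)).comp t h1
    have hB : ∀ t : ℝ, HasDerivAt
        (fun t : ℝ => M * ‖z‖ ^ (n + 1) / (n + 1).factorial * t ^ (n + 1))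
        (M * ‖z‖ ^ (n + 1) / n.factorial * t ^ n) t := by
      intro t
      have h := (hasDerivAt_pow (n + 1) t).const_mul (M * ‖z‖ ^ (n + 1) / (n + 1).factorial)
      refine h.congr_deriv ?_
      rw [Nat.factorial_succ]
      have : (n.factorial : ℝ) ≠ 0 := by exact_mod_cast n.factorial_ne_zero
      have : (n + 1 : ℝ) ≠ 0 := by exact_mod_cast n.succ_ne_zero
      push_cast
      field_simp
    have key := image_norm_le_of_norm_deriv_right_le_deriv_boundary (a := 0) (b := 1)
      (fun t _ => (hd t).continuousAt.continuousWithinAt)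
      (fun t _ => (hd t).hasDerivWithinAt) (by simp [Finset.sum_range_succ']) hB
      (fun t ht => by
        rw [norm_mul]
        have h2 : max 1 (Real.exp ((t : ℂ) * z).re) ≤ M := by
          refine max_le (le_max_left _ _) ?_
          rw [Complex.re_ofReal_mul]
          rcases le_total z.re 0 with h | h
          · exact le_max_of_le_left (Real.exp_le_one_iff.2 (mul_nonpos_of_nonneg_of_nonpos ht.1 h))
          · exact le_max_of_le_right (Real.exp_le_exp.2 (mul_le_of_le_one_left h ht.2.le))
        calc _ ≤ ‖(t : ℂ) * z‖ ^ n / n.factorial * M * ‖z‖ := by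
              gcongr
              exact (ih _).trans (by gcongr)
          _ = _ := by
              rw [norm_mul, Complex.norm_real, Real.norm_of_nonneg ht.1]
              ring)
      (x := 1) (by simp)
    calc _ ≤ _ := by simpa using key
      _ = _ := by ring

/-- Taylor bound for `exp (-v)` on the right half-plane. -/
lemma norm_exp_neg_sub_sum_le {v : ℂ} (hv : 0 ≤ v.re) (n : ℕ) :
    ‖Complex.exp (-v) - ∑ k ∈ Finset.range n, (-v) ^ k / (k.factorial : ℂ)‖ ≤
      ‖v‖ ^ n / n.factorial := by
  have h := norm_exp_sub_sum_le_max n (-v)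
  rwa [max_eq_left (by simpa using hv), mul_one, norm_neg] at h

/-- Gaussian decay absorbs polynomial and exponential growth. -/
lemma exists_pow_mul_exp_sub_sq_le (k : ℕ) (a b : ℝ) {c : ℝ} (hc : 0 < c) :
    ∃ K : ℝ, ∀ s : ℝ, (1 + |s|) ^ k * Real.exp (a + b * (1 + |s|) - c * s ^ 2) ≤
      K * Real.exp (-(c / 2) * s ^ 2) := by
  refine ⟨k.factorial * Real.exp (a + (|b| + 1) + (|b| + 1) ^ 2 / (2 * c)), fun s => ?_⟩
  have hs : 0 ≤ |s| := abs_nonneg s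
  rw [mul_assoc, ← Real.exp_add]
  have h1 : (1 + |s|) ^ k ≤ k.factorial * Real.exp (1 + |s|) := by
    have := Real.pow_div_factorial_le_exp (x := 1 + |s|) (by positivity) k
    rwa [div_le_iff₀' (by positivity)] at this
  calc _ ≤ k.factorial * Real.exp (1 + |s|) * Real.exp (a + b * (1 + |s|) - c * s ^ 2) := by gcongr
    _ = k.factorial * Real.exp (1 + |s| + (a + b * (1 + |s|) - c * s ^ 2)) := by
        rw [mul_assoc, Real.exp_add (1 + |s|)]
    _ ≤ _ := by
        refine mul_le_mul_of_nonneg_left (Real.exp_le_exp.2 ?_) (by positivity)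
        have h2 : b * (1 + |s|) ≤ |b| * (1 + |s|) := by
          gcongr; exact le_abs_self b
        have h3 : (|b| + 1) * |s| ≤ (|b| + 1) ^ 2 / (2 * c) + c / 2 * |s| ^ 2 := by
          have : (|b| + 1) ^ 2 / (2 * c) + c / 2 * |s| ^ 2 - (|b| + 1) * |s| =
            ((|b| + 1) - c * |s|) ^ 2 / (2 * c) := by field_simp; ring
          have : 0 ≤ ((|b| + 1) - c * |s|) ^ 2 / (2 * c) := by positivity
          linarith
        rw [sq_abs] at h3
        nlinarith

lemma integrable_pow_mul_exp_sub_sq (k : ℕ) (a b : ℝ) {c : ℝ} (hc : 0 < c) :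
    Integrable fun s : ℝ => (1 + |s|) ^ k * Real.exp (a + b * (1 + |s|) - c * s ^ 2) := by
  obtain ⟨K, hK⟩ := exists_pow_mul_exp_sub_sq_le k a b hc
  refine ((integrable_exp_neg_mul_sq (half_pos hc)).const_mul K).mono' (by fun_prop)
    (ae_of_all _ fun s => ?_)
  rw [Real.norm_of_nonneg (by positivity)]
  exact hK s

lemma tendsto_pow_mul_exp_sub_sq (k : ℕ) (a b : ℝ) {c : ℝ} (hc : 0 < c) :
    Tendsto (fun s : ℝ => (1 + |s|) ^ k * Real.exp (a + b * (1 + |s|) - c * s ^ 2)) atTop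
      (𝓝 0) := by
  obtain ⟨K, hK⟩ := exists_pow_mul_exp_sub_sq_le k a b hc
  refine squeeze_zero (fun s => by positivity) hK ?_
  rw [← mul_zero K]
  refine (Real.tendsto_exp_atBot.comp ?_).const_mul K
  exact (tendsto_pow_atTop two_ne_zero).const_mul_atTop_of_neg (by linarith)

lemma exp_pi_div_three_mul_I :
    Complex.exp (((Real.pi / 3 : ℝ) : ℂ) * Complex.I) = 1 / 2 + (Real.sqrt 3 / 2 : ℝ) * Complex.I := by
  rw [Complex.exp_mul_I, ← Complex.ofReal_cos, ← Complex.ofReal_sin, Real.cos_pi_div_three,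
    Real.sin_pi_div_three]
  push_cast
  ring

lemma exp_neg_pi_div_three_mul_I :
    Complex.exp (-((Real.pi / 3 : ℝ) : ℂ) * Complex.I) =
      1 / 2 - (Real.sqrt 3 / 2 : ℝ) * Complex.I := by
  rw [Complex.exp_mul_I, Complex.cos_neg, Complex.sin_neg, ← Complex.ofReal_cos,
    ← Complex.ofReal_sin, Real.cos_pi_div_three, Real.sin_pi_div_three]
  push_cast
  ring

/-- Cartesian form of the Airy contour. -/
lemma airyPath_eq (s : ℝ) :
    airyPath (Real.pi / 3) s =
      ((max 1 |s| / 2 : ℝ) : ℂ) + ((s * Real.sqrt 3 / 2 : ℝ) : ℂ) * Complex.I := by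
  unfold airyPath
  split_ifs with h1 h2
  · rw [exp_neg_pi_div_three_mul_I, abs_of_nonpos (by linarith), max_eq_right (by linarith)]
    push_cast
    ring
  · rw [Real.cos_pi_div_three, Real.sin_pi_div_three,
      max_eq_left (abs_le.2 ⟨(not_le.1 h1).le, h2⟩)]
    push_cast
    ring
  · rw [exp_pi_div_three_mul_I, abs_of_nonneg (by linarith), max_eq_right (by linarith)]
    push_cast
    ring

lemma airyPath_re (s : ℝ) : (airyPath (Real.pi / 3) s).re = max 1 |s| / 2 := by
  rw [airyPath_eq]; simp

lemma airyPath_im (s : ℝ) : (airyPath (Real.pi / 3) s).im = s * Real.sqrt 3 / 2 := by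
  rw [airyPath_eq]; simp

lemma continuous_airyPath : Continuous (airyPath (Real.pi / 3)) := by
  rw [funext airyPath_eq]
  fun_prop

lemma airyPath_re_pos (s : ℝ) : 0 < (airyPath (Real.pi / 3) s).re := by
  rw [airyPath_re]; positivity

lemma norm_airyPath_sq (s : ℝ) :
    ‖airyPath (Real.pi / 3) s‖ ^ 2 = (max 1 |s|) ^ 2 / 4 + 3 * s ^ 2 / 4 := by
  rw [← Complex.normSq_eq_norm_sq, Complex.normSq_apply, airyPath_re, airyPath_im]
  have : Real.sqrt 3 ^ 2 = 3 := Real.sq_sqrt (by norm_num)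
  nlinarith

lemma norm_airyPath_le_max (s : ℝ) : ‖airyPath (Real.pi / 3) s‖ ≤ max 1 |s| := by
  have h0 : (0 : ℝ) ≤ max 1 |s| := by positivity
  refine abs_le_of_sq_le_sq' ?_ h0 |>.2
  rw [norm_airyPath_sq]
  have : |s| ^ 2 ≤ (max 1 |s|) ^ 2 := by gcongr; exact le_max_right _ _
  rw [sq_abs] at this
  linarith

lemma norm_airyPath_le (s : ℝ) : ‖airyPath (Real.pi / 3) s‖ ≤ 1 + |s| :=
  (norm_airyPath_le_max s).trans (max_le (by linarith [abs_nonneg s]) (by linarith))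

lemma norm_airyPath_of_one_le {s : ℝ} (hs : 1 ≤ |s|) : ‖airyPath (Real.pi / 3) s‖ = |s| := by
  rw [← sq_eq_sq₀ (norm_nonneg _) (abs_nonneg s), norm_airyPath_sq, max_eq_right hs, sq_abs]
  ring

lemma airyPath_sq_re {s : ℝ} (hs : 1 ≤ |s|) :
    ((airyPath (Real.pi / 3) s) ^ 2).re = -(s ^ 2 / 2) := by
  rw [sq, Complex.mul_re, airyPath_re, airyPath_im, max_eq_right hs]
  have h3 : Real.sqrt 3 ^ 2 = 3 := Real.sq_sqrt (by norm_num)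
  have := sq_abs s
  linear_combination (1 / 4 : ℝ) * this - s ^ 2 / 4 * h3

lemma airyPath_cube {s : ℝ} (hs : 1 ≤ |s|) :
    (airyPath (Real.pi / 3) s) ^ 3 = ((-|s| ^ 3 : ℝ) : ℂ) := by
  rw [airyPath_eq, max_eq_right hs]
  have h3 : ((Real.sqrt 3 : ℝ) : ℂ) ^ 2 = 3 := by
    rw [← Complex.ofReal_pow, Real.sq_sqrt (by norm_num)]; simp
  have h4 : ((|s| : ℝ) : ℂ) ^ 2 = (s : ℂ) ^ 2 := by
    rw [← Complex.ofReal_pow, sq_abs, Complex.ofReal_pow]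
  have hI := Complex.I_sq
  push_cast
  generalize ((Real.sqrt 3 : ℝ) : ℂ) = q at *
  generalize ((|s| : ℝ) : ℂ) = u at *
  have hq3 : q ^ 3 = 3 * q := by rw [pow_succ, h3]
  have hI3 : Complex.I ^ 3 = -Complex.I := by rw [pow_succ, hI]; ring
  have hu3 : u ^ 3 = s ^ 2 * u := by rw [pow_succ, h4]
  ring_nf
  rw [hq3, hI3, hI, h3, hu3, h4]
  ring

lemma hasDerivAt_airyPath {s : ℝ} (hs : s ∉ ({-1, 1} : Set ℝ)) :
    HasDerivAt (airyPath (Real.pi / 3)) (airyPathDeriv (Real.pi / 3) s) s := by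
  have hlin : ∀ a b : ℂ, HasDerivAt (fun s : ℝ => a + b * (s : ℂ)) b s := fun a b => by
    simpa using ((Complex.ofRealCLM.hasDerivAt (x := s)).const_mul b).const_add a
  simp only [Set.mem_insert_iff, Set.mem_singleton_iff, not_or] at hs
  unfold airyPathDeriv
  split_ifs with h1 h2
  · refine (hlin 0 _).congr_of_eventuallyEq ?_
    filter_upwards [Iio_mem_nhds (lt_of_le_of_ne h1 hs.1)] with t ht
    simp [airyPath, (Set.mem_Iio.1 ht).le]
  · refine (hlin (Real.cos (Real.pi / 3)) _).congr_of_eventuallyEq ?_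
    filter_upwards [Ioi_mem_nhds (not_le.1 h1), Iio_mem_nhds (lt_of_le_of_ne h2 hs.2)] with t ht ht'
    rw [airyPath, if_neg (not_le.2 ht), if_pos (Set.mem_Iio.1 ht').le]
    ring
  · refine (hlin 0 _).congr_of_eventuallyEq ?_
    filter_upwards [Ioi_mem_nhds (not_le.1 h2)] with t ht
    rw [airyPath, if_neg (not_le.2 (by linarith [Set.mem_Ioi.1 ht])), if_neg (not_le.2 ht)]
    ring

lemma norm_airyPathDeriv_le (s : ℝ) : ‖airyPathDeriv (Real.pi / 3) s‖ ≤ 1 := by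
  unfold airyPathDeriv
  split_ifs with h1 h2
  · rw [norm_neg, ← Complex.ofReal_neg, Complex.norm_exp_ofReal_mul_I]
  · rw [norm_mul, Complex.norm_I, one_mul, Complex.norm_real]
    exact Real.abs_sin_le_one _
  · rw [Complex.norm_exp_ofReal_mul_I]

lemma measurable_airyPathDeriv : Measurable (airyPathDeriv (Real.pi / 3)) :=
  Measurable.ite measurableSet_Iic measurable_const
    (Measurable.ite measurableSet_Iic measurable_const measurable_const)

/-- The fundamental theorem of calculus along the Airy contour. -/
lemma intervalIntegral_airyPath {P H : ℂ → ℂ} (hP : ∀ v, HasDerivAt P (H v) v) {b : ℂ} {N : ℝ}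
    (hN : 0 ≤ N)
    (hi : Integrable fun s => H (b * airyPath (Real.pi / 3) s) * airyPathDeriv (Real.pi / 3) s) :
    ∫ s in (-N)..N, H (b * airyPath (Real.pi / 3) s) * airyPathDeriv (Real.pi / 3) s * b =
      P (b * airyPath (Real.pi / 3) N) - P (b * airyPath (Real.pi / 3) (-N)) := by
  refine integral_eq_of_hasDerivAt_off_countable_of_le
    (fun s => P (b * airyPath (Real.pi / 3) s)) _ (by linarith)
    (s := {-1, 1}) (Set.toFinite _).countable ?_ ?_ (hi.mul_const b).intervalIntegrable
  · have hPc : Continuous P := continuous_iff_continuousAt.2 fun v => (hP v).continuousAt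
    exact (hPc.comp (continuous_const.mul continuous_airyPath)).continuousOn
  · intro s hs
    have h1 := (hasDerivAt_airyPath hs.2).const_mul b
    have h2 := (hP (b * airyPath (Real.pi / 3) s)).comp s h1
    refine h2.congr_deriv ?_
    ring

/-- Deformation of the vertical line `Re v = 1` into a scaled Airy contour. -/
lemma integral_vertical_eq_integral_airyPath {H : ℂ → ℂ} (hH : Differentiable ℂ H) {b q C : ℝ}
    (hb : 0 < b) (hq : 0 < q)
    (hbd : ∀ v : ℂ, 0 ≤ v.re → ‖H v‖ ≤ C * Real.exp (q * ((1 - v) ^ 2).re))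
    (hi : Integrable fun s =>
      H ((b : ℂ) * airyPath (Real.pi / 3) s) * airyPathDeriv (Real.pi / 3) s) :
    ∫ x : ℝ, H (1 + x * Complex.I) * Complex.I =
      ∫ s : ℝ, H ((b : ℂ) * airyPath (Real.pi / 3) s) * airyPathDeriv (Real.pi / 3) s * b := by
  obtain ⟨P, hP'⟩ := hH.isExactOn_univ
  have hP : ∀ v, HasDerivAt P (H v) v := fun v => hP' v trivial
  have hC : 0 ≤ C := by
    have := (norm_nonneg _).trans (hbd 1 (by simp))
    simpa using this
  have hre : ∀ a y : ℝ, ((1 - (a + y * Complex.I)) ^ 2 : ℂ).re = (1 - a) ^ 2 - y ^ 2 := by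
    intro a y
    simp [sq, Complex.mul_re]
  have hvert : Integrable fun x : ℝ => H (1 + x * Complex.I) * Complex.I := by
    refine ((integrable_exp_neg_mul_sq hq).const_mul C).mono' ?_ (ae_of_all _ fun x => ?_)
    · have := hH.continuous
      exact (by fun_prop : Continuous fun x : ℝ => H (1 + x * Complex.I) * Complex.I).aestronglyMeasurable
    · have h1 := hbd (1 + x * Complex.I) (by simp)
      have h2 := hre 1 x
      rw [Complex.ofReal_one] at h2
      rw [h2] at h1
      simpa using h1
  have hY : Tendsto (fun N : ℝ => b * N * Real.sqrt 3 / 2) atTop atTop := by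
    have h : 0 < b * Real.sqrt 3 / 2 := by positivity
    refine (tendsto_id.const_mul_atTop h).congr fun N => ?_
    simp only [id]; ring
  have t1 := intervalIntegral_tendsto_integral (hi.mul_const (b : ℂ)) tendsto_neg_atTop_atBot
    tendsto_id
  have t2 := intervalIntegral_tendsto_integral hvert (tendsto_neg_atTop_atBot.comp hY) hY
  have hside : ∀ N y : ℝ, 1 ≤ N → 2 ≤ b * N → y ^ 2 = 3 * (b * N) ^ 2 / 4 →
      ‖P ((b * N / 2 : ℝ) + y * Complex.I) - P (1 + y * Complex.I)‖ ≤
        C * (2 / (q * (b * N))) := by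
    intro N y hN hbN hy
    have hconv : Convex ℝ (Set.Icc 1 (b * N / 2) ×ℂ {y}) :=
      ((convex_Icc _ _).linear_preimage Complex.reLm).inter
        ((convex_singleton y).linear_preimage Complex.imLm)
    have h := hconv.norm_image_sub_le_of_norm_hasDerivWithin_le
      (C := C * Real.exp (-(q * (b * N) ^ 2 / 2)))
      (fun v _ => (hP v).hasDerivWithinAt) (fun v hv => by
        rw [Complex.mem_reProdIm] at hv
        refine (hbd v (by linarith [hv.1.1])).trans ?_
        gcongr
        have h3 := hre v.re v.im
        rw [Complex.re_add_im] at h3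
        rw [h3, (hv.2 : v.im = y), hy]
        have h4 : (1 - v.re) ^ 2 ≤ (b * N / 2) ^ 2 := by
          rw [← neg_sq]
          have := hv.1.1
          have := hv.1.2
          gcongr <;> linarith
        nlinarith)
      (x := 1 + y * Complex.I) (y := (b * N / 2 : ℝ) + y * Complex.I)
      (by rw [Complex.mem_reProdIm]; simp; linarith)
      (by rw [Complex.mem_reProdIm]; simp; linarith)
    refine h.trans ?_
    have h5 : ‖((b * N / 2 : ℝ) + y * Complex.I : ℂ) - (1 + y * Complex.I)‖ ≤ b * N := by
      have : ((b * N / 2 : ℝ) + y * Complex.I : ℂ) - (1 + y * Complex.I) =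
          ((b * N / 2 - 1 : ℝ) : ℂ) := by push_cast; ring
      rw [this, Complex.norm_real, Real.norm_of_nonneg (by linarith)]
      linarith
    have h6 : Real.exp (-(q * (b * N) ^ 2 / 2)) ≤ (q * (b * N) ^ 2 / 2)⁻¹ := by
      rw [Real.exp_neg]
      have : 0 < q * (b * N) ^ 2 / 2 := by positivity
      gcongr
      linarith [Real.add_one_le_exp (q * (b * N) ^ 2 / 2)]
    calc _ ≤ C * (q * (b * N) ^ 2 / 2)⁻¹ * (b * N) := by gcongr
      _ = _ := by field_simp
  have t3 : Tendsto (fun N : ℝ => 2 * (C * (2 / (q * (b * N))))) atTop (𝓝 0) := by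
    have : Tendsto (fun N : ℝ => (4 * C / (q * b)) * N⁻¹) atTop (𝓝 ((4 * C / (q * b)) * 0)) :=
      tendsto_inv_atTop_zero.const_mul _
    rw [mul_zero] at this
    refine this.congr fun N => ?_
    field_simp
    ring
  have t4 : Tendsto (fun N : ℝ =>
      (∫ x in (-(b * N * Real.sqrt 3 / 2))..(b * N * Real.sqrt 3 / 2),
        H (1 + x * Complex.I) * Complex.I) -
      ∫ s in (-N)..N,
        H ((b : ℂ) * airyPath (Real.pi / 3) s) * airyPathDeriv (Real.pi / 3) s * b) atTop
      (𝓝 0) := by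
    refine squeeze_zero_norm' ?_ t3
    filter_upwards [eventually_ge_atTop 1, eventually_ge_atTop (2 / b)] with N hN hN2
    have hbN : 2 ≤ b * N := by rwa [div_le_iff₀' hb] at hN2
    set y := b * N * Real.sqrt 3 / 2 with hy
    have hy2 : y ^ 2 = 3 * (b * N) ^ 2 / 4 := by
      rw [hy, div_pow, mul_pow, Real.sq_sqrt (by norm_num)]; ring
    rw [intervalIntegral_airyPath hP (by linarith) hi]
    have hv : ∀ x : ℝ, HasDerivAt (fun x : ℝ => P (1 + x * Complex.I))
        (H (1 + x * Complex.I) * Complex.I) x := by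
      intro x
      have h1 : HasDerivAt (fun x : ℝ => 1 + (x : ℂ) * Complex.I) Complex.I x := by
        simpa using ((Complex.ofRealCLM.hasDerivAt (x := x)).mul_const Complex.I).const_add 1
      exact (hP _).comp x h1
    rw [intervalIntegral.integral_eq_sub_of_hasDerivAt (fun x _ => hv x) hvert.intervalIntegrable]
    have e1 : (b : ℂ) * airyPath (Real.pi / 3) N = (b * N / 2 : ℝ) + y * Complex.I := by
      rw [airyPath_eq, abs_of_nonneg (by linarith), max_eq_right hN, hy]; push_cast; ring
    have e2 : (b : ℂ) * airyPath (Real.pi / 3) (-N) =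
        (b * N / 2 : ℝ) + (-y : ℝ) * Complex.I := by
      rw [airyPath_eq, abs_neg, abs_of_nonneg (by linarith), max_eq_right hN, hy]; push_cast; ring
    rw [e1, e2]
    have s1 := hside N y hN hbN hy2
    have s2 := hside N (-y) hN hbN (by rw [neg_sq, hy2])
    calc _ = ‖(P ((b * N / 2 : ℝ) + (-y : ℝ) * Complex.I) - P (1 + (-y : ℝ) * Complex.I)) -
          (P ((b * N / 2 : ℝ) + y * Complex.I) - P (1 + y * Complex.I))‖ := by
          congr 1; ring
      _ ≤ _ := by
          refine (norm_sub_le _ _).trans ?_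
          linarith
  have t5 := t2.sub t1
  exact sub_eq_zero.1 (tendsto_nhds_unique t5 t4)

/-- The moments `∫ exp (-z t + t³ / 3) t ^ k dt` along the Airy contour. -/
noncomputable def airyMoment (z : ℂ) (k : ℕ) : ℂ :=
  ∫ s : ℝ, Complex.exp (-z * airyPath (Real.pi / 3) s + (airyPath (Real.pi / 3) s) ^ 3 / 3) *
    (airyPath (Real.pi / 3) s) ^ k * airyPathDeriv (Real.pi / 3) s

lemma norm_airy_exp_le (z : ℂ) (s : ℝ) :
    ‖Complex.exp (-z * airyPath (Real.pi / 3) s + (airyPath (Real.pi / 3) s) ^ 3 / 3)‖ ≤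
      Real.exp (1 + ‖z‖ * (1 + |s|) - 1 / 12 * s ^ 2) := by
  rw [Complex.norm_exp]
  gcongr
  rw [Complex.add_re]
  have h1 : (-z * airyPath (Real.pi / 3) s).re ≤ ‖z‖ * (1 + |s|) := by
    refine (Complex.re_le_norm _).trans ?_
    rw [norm_mul, norm_neg]
    gcongr
    exact norm_airyPath_le s
  have h2 : ((airyPath (Real.pi / 3) s) ^ 3 / 3).re ≤ 1 - 1 / 12 * s ^ 2 := by
    rcases le_total 1 |s| with h | h
    · rw [airyPath_cube h]
      have e : (((-|s| ^ 3 : ℝ) : ℂ) / 3).re = -|s| ^ 3 / 3 := by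
        rw [show (3 : ℂ) = ((3 : ℝ) : ℂ) by simp, ← Complex.ofReal_div, Complex.ofReal_re]
      rw [e, ← sq_abs s]
      nlinarith [sq_nonneg |s|]
    · refine (Complex.re_le_norm _).trans ?_
      have h3 := norm_airyPath_le_max s
      rw [max_eq_left h] at h3
      have h4 : ‖airyPath (Real.pi / 3) s‖ ^ 3 ≤ 1 := pow_le_one₀ (norm_nonneg _) h3
      rw [norm_div, norm_pow, Complex.norm_ofNat, ← sq_abs s]
      nlinarith [abs_nonneg s]
  linarith

lemma norm_airyMoment_integrand_le (z : ℂ) (k : ℕ) (s : ℝ) :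
    ‖Complex.exp (-z * airyPath (Real.pi / 3) s + (airyPath (Real.pi / 3) s) ^ 3 / 3) *
      (airyPath (Real.pi / 3) s) ^ k‖ ≤
      (1 + |s|) ^ k * Real.exp (1 + ‖z‖ * (1 + |s|) - 1 / 12 * s ^ 2) := by
  rw [norm_mul, norm_pow, mul_comm]
  gcongr
  · exact norm_airyPath_le s
  · exact norm_airy_exp_le z s

lemma aestronglyMeasurable_airyMoment_integrand (z : ℂ) (k : ℕ) :
    AEStronglyMeasurable fun s : ℝ =>
      Complex.exp (-z * airyPath (Real.pi / 3) s + (airyPath (Real.pi / 3) s) ^ 3 / 3) *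
        (airyPath (Real.pi / 3) s) ^ k * airyPathDeriv (Real.pi / 3) s := by
  have := continuous_airyPath
  exact (by fun_prop : Continuous fun s : ℝ =>
      Complex.exp (-z * airyPath (Real.pi / 3) s + (airyPath (Real.pi / 3) s) ^ 3 / 3) *
        (airyPath (Real.pi / 3) s) ^ k).aestronglyMeasurable.mul
    measurable_airyPathDeriv.aestronglyMeasurable

lemma norm_mul_airyPathDeriv_le (x : ℂ) (s : ℝ) :
    ‖x * airyPathDeriv (Real.pi / 3) s‖ ≤ ‖x‖ := by
  rw [norm_mul]
  exact mul_le_of_le_one_right (norm_nonneg _) (norm_airyPathDeriv_le s)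

lemma integrable_airyMoment_integrand (z : ℂ) (k : ℕ) :
    Integrable fun s : ℝ =>
      Complex.exp (-z * airyPath (Real.pi / 3) s + (airyPath (Real.pi / 3) s) ^ 3 / 3) *
        (airyPath (Real.pi / 3) s) ^ k * airyPathDeriv (Real.pi / 3) s :=
  (integrable_pow_mul_exp_sub_sq k 1 ‖z‖ (by norm_num)).mono'
    (aestronglyMeasurable_airyMoment_integrand z k)
    (ae_of_all _ fun s =>
      (norm_mul_airyPathDeriv_le _ s).trans (norm_airyMoment_integrand_le z k s))

lemma airyAi_eq_airyMoment (z : ℂ) :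
    airyAi z = 1 / (2 * (Real.pi : ℂ) * Complex.I) * airyMoment z 0 := by
  simp [airyAi, airyMoment]

lemma airyAi'_eq_airyMoment (z : ℂ) :
    airyAi' z = -(1 / (2 * (Real.pi : ℂ) * Complex.I)) * airyMoment z 1 := by
  have h := hasDerivAt_integral_of_dominated_loc_of_deriv_le (μ := volume) (x₀ := z)
    (s := Metric.ball z 1)
    (F := fun (y : ℂ) (s : ℝ) =>
      Complex.exp (-y * airyPath (Real.pi / 3) s + (airyPath (Real.pi / 3) s) ^ 3 / 3) *
        (airyPath (Real.pi / 3) s) ^ 0 * airyPathDeriv (Real.pi / 3) s)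
    (F' := fun (y : ℂ) (s : ℝ) =>
      -(Complex.exp (-y * airyPath (Real.pi / 3) s + (airyPath (Real.pi / 3) s) ^ 3 / 3) *
        (airyPath (Real.pi / 3) s) ^ 1 * airyPathDeriv (Real.pi / 3) s))
    (bound := fun s => (1 + |s|) ^ 1 * Real.exp (1 + (‖z‖ + 1) * (1 + |s|) - 1 / 12 * s ^ 2))
    (Metric.ball_mem_nhds z one_pos)
    (Eventually.of_forall fun y => aestronglyMeasurable_airyMoment_integrand y 0)
    (integrable_airyMoment_integrand z 0)
    (aestronglyMeasurable_airyMoment_integrand z 1).neg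
    (ae_of_all _ fun s y hy => by
      rw [norm_neg]
      refine (norm_mul_airyPathDeriv_le _ s).trans
        ((norm_airyMoment_integrand_le y 1 s).trans ?_)
      have : ‖y‖ ≤ ‖z‖ + 1 := by
        have h1 : ‖y - z‖ < 1 := by simpa [dist_eq_norm] using hy
        linarith [norm_sub_norm_le y z]
      gcongr)
    (integrable_pow_mul_exp_sub_sq 1 1 (‖z‖ + 1) (by norm_num))
    (ae_of_all _ fun s y _ => by
      have h1 : HasDerivAt (fun y : ℂ => -y * airyPath (Real.pi / 3) s +
          (airyPath (Real.pi / 3) s) ^ 3 / 3) (-airyPath (Real.pi / 3) s) y := by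
        simpa using ((hasDerivAt_id y).neg.mul_const
          (airyPath (Real.pi / 3) s)).add_const ((airyPath (Real.pi / 3) s) ^ 3 / 3)
      refine ((h1.cexp.mul_const _).mul_const _).congr_deriv ?_
      ring)
  have h2 := h.2
  rw [integral_neg] at h2
  have h3 := (h2.const_mul (1 / (2 * (Real.pi : ℂ) * Complex.I))).deriv
  rw [airyAi', show airyAi = fun y => 1 / (2 * (Real.pi : ℂ) * Complex.I) * airyMoment y 0 from
    funext airyAi_eq_airyMoment]
  refine Eq.trans h3 ?_
  rw [airyMoment]
  ring

/-- Integration by parts for the moments, in the form of an exact derivative. -/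
lemma airyMoment_add_two (z : ℂ) (k : ℕ) :
    airyMoment z (k + 2) = z * airyMoment z k - k * airyMoment z (k - 1) := by
  set P : ℂ → ℂ := fun v => Complex.exp (-z * v + v ^ 3 / 3) * v ^ k with hPdef
  set H : ℂ → ℂ := fun v => Complex.exp (-z * v + v ^ 3 / 3) * v ^ (k + 2) -
    z * (Complex.exp (-z * v + v ^ 3 / 3) * v ^ k) +
    k * (Complex.exp (-z * v + v ^ 3 / 3) * v ^ (k - 1)) with hHdef
  have hP : ∀ v, HasDerivAt P (H v) v := by
    intro v
    have h1 : HasDerivAt (fun v : ℂ => -z * v + v ^ 3 / 3) (-z + v ^ 2) v := by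
      refine (((hasDerivAt_id v).const_mul (-z)).add
        ((hasDerivAt_pow 3 v).div_const 3)).congr_deriv ?_
      push_cast
      ring
    refine (h1.cexp.mul (hasDerivAt_pow k v)).congr_deriv ?_
    simp only [hHdef]
    ring
  have i0 := integrable_airyMoment_integrand z k
  have i1 := integrable_airyMoment_integrand z (k - 1)
  have i2 := integrable_airyMoment_integrand z (k + 2)
  have hsplit : (fun s : ℝ => H (1 * airyPath (Real.pi / 3) s) * airyPathDeriv (Real.pi / 3) s) =
      fun s : ℝ => Complex.exp (-z * airyPath (Real.pi / 3) s + (airyPath (Real.pi / 3) s) ^ 3 / 3) *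
        (airyPath (Real.pi / 3) s) ^ (k + 2) * airyPathDeriv (Real.pi / 3) s -
      z * (Complex.exp (-z * airyPath (Real.pi / 3) s + (airyPath (Real.pi / 3) s) ^ 3 / 3) *
        (airyPath (Real.pi / 3) s) ^ k * airyPathDeriv (Real.pi / 3) s) +
      k * (Complex.exp (-z * airyPath (Real.pi / 3) s + (airyPath (Real.pi / 3) s) ^ 3 / 3) *
        (airyPath (Real.pi / 3) s) ^ (k - 1) * airyPathDeriv (Real.pi / 3) s) := by
    funext s
    simp only [hHdef, one_mul]
    ring
  have hi : Integrable fun s : ℝ =>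
      H (1 * airyPath (Real.pi / 3) s) * airyPathDeriv (Real.pi / 3) s := by
    rw [hsplit]
    exact (i2.sub (i0.const_mul z)).add (i1.const_mul _)
  have hval : ∫ s : ℝ, H (1 * airyPath (Real.pi / 3) s) * airyPathDeriv (Real.pi / 3) s =
      airyMoment z (k + 2) - z * airyMoment z k + k * airyMoment z (k - 1) := by
    rw [hsplit]
    refine (integral_add (i2.sub (i0.const_mul z)) (i1.const_mul (k : ℂ))).trans ?_
    rw [integral_const_mul]
    refine congrArg (· + _) ((integral_sub i2 (i0.const_mul z)).trans ?_)
    rw [integral_const_mul]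
    rfl
  have hlim : ∀ σ : ℝ, |σ| = 1 →
      Tendsto (fun N : ℝ => P (1 * airyPath (Real.pi / 3) (σ * N))) atTop (𝓝 0) := by
    intro σ hσ
    refine squeeze_zero_norm (fun N => ?_) (tendsto_pow_mul_exp_sub_sq k 1 ‖z‖
      (by norm_num : (0 : ℝ) < 1 / 12))
    have h := norm_airyMoment_integrand_le z k (σ * N)
    rw [mul_pow, ← sq_abs σ, abs_mul, hσ, one_pow, one_mul, one_mul] at h
    simpa only [hPdef, one_mul] using h
  have t1 := intervalIntegral_tendsto_integral hi tendsto_neg_atTop_atBot tendsto_id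
  have t2 := (hlim 1 (by simp)).sub (hlim (-1) (by simp))
  have t3 : ∫ s : ℝ, H (1 * airyPath (Real.pi / 3) s) * airyPathDeriv (Real.pi / 3) s = 0 - 0 := by
    refine tendsto_nhds_unique t1 (t2.congr' ?_)
    filter_upwards [eventually_ge_atTop 0] with N hN
    have h := intervalIntegral_airyPath hP (b := 1) hN hi
    simp only [mul_one] at h
    simp only [id, one_mul, neg_mul] at h ⊢
    exact h.symm
  rw [hval] at t3
  linear_combination t3

/-- `f ε s` is bounded by `ε ^ j` times a polynomial in `|s|`, uniformly in `0 < ε ≤ min 1 ε₀`. -/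
def PolyBound (ε₀ : ℝ) (j : ℕ) (f : ℝ → ℝ → ℂ) : Prop :=
  ∃ (C : ℝ) (k : ℕ), 0 ≤ C ∧ ∀ ε s : ℝ, 0 < ε → ε ≤ 1 → ε ≤ ε₀ →
    ‖f ε s‖ ≤ C * ε ^ j * (1 + |s|) ^ k

namespace PolyBound

variable {ε₀ : ℝ} {i j : ℕ} {f g : ℝ → ℝ → ℂ}

lemma of_le (hg : PolyBound ε₀ j g)
    (h : ∀ ε s : ℝ, 0 < ε → ε ≤ 1 → ε ≤ ε₀ → ‖f ε s‖ ≤ ‖g ε s‖) : PolyBound ε₀ j f := by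
  obtain ⟨C, k, hC, hb⟩ := hg
  exact ⟨C, k, hC, fun ε s h0 h1 h2 => (h ε s h0 h1 h2).trans (hb ε s h0 h1 h2)⟩

lemma congr (hg : PolyBound ε₀ j g)
    (h : ∀ ε s : ℝ, 0 < ε → f ε s = g ε s) : PolyBound ε₀ j f :=
  hg.of_le fun ε s h0 _ _ => by rw [h ε s h0]

lemma mono (hf : PolyBound ε₀ j f) (hij : i ≤ j) : PolyBound ε₀ i f := by
  obtain ⟨C, k, hC, hb⟩ := hf
  refine ⟨C, k, hC, fun ε s h0 h1 h2 => (hb ε s h0 h1 h2).trans ?_⟩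
  have : ε ^ j ≤ ε ^ i := pow_le_pow_of_le_one h0.le h1 hij
  gcongr

lemma add (hf : PolyBound ε₀ j f) (hg : PolyBound ε₀ j g) :
    PolyBound ε₀ j fun ε s => f ε s + g ε s := by
  obtain ⟨C, k, hC, hb⟩ := hf
  obtain ⟨C', k', hC', hb'⟩ := hg
  refine ⟨C + C', max k k', by positivity, fun ε s h0 h1 h2 => ?_⟩
  have hs : 1 ≤ 1 + |s| := by linarith [abs_nonneg s]
  have e1 : (1 + |s|) ^ k ≤ (1 + |s|) ^ max k k' := pow_le_pow_right₀ hs (le_max_left _ _)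
  have e2 : (1 + |s|) ^ k' ≤ (1 + |s|) ^ max k k' := pow_le_pow_right₀ hs (le_max_right _ _)
  calc _ ≤ ‖f ε s‖ + ‖g ε s‖ := norm_add_le _ _
    _ ≤ C * ε ^ j * (1 + |s|) ^ max k k' + C' * ε ^ j * (1 + |s|) ^ max k k' := by
        refine add_le_add ((hb ε s h0 h1 h2).trans ?_) ((hb' ε s h0 h1 h2).trans ?_) <;> gcongr
    _ = _ := by ring

lemma mul (hf : PolyBound ε₀ i f) (hg : PolyBound ε₀ j g) :
    PolyBound ε₀ (i + j) fun ε s => f ε s * g ε s := by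
  obtain ⟨C, k, hC, hb⟩ := hf
  obtain ⟨C', k', hC', hb'⟩ := hg
  refine ⟨C * C', k + k', by positivity, fun ε s h0 h1 h2 => ?_⟩
  calc _ = ‖f ε s‖ * ‖g ε s‖ := norm_mul _ _
    _ ≤ (C * ε ^ i * (1 + |s|) ^ k) * (C' * ε ^ j * (1 + |s|) ^ k') := by
        gcongr
        · exact hb ε s h0 h1 h2
        · exact hb' ε s h0 h1 h2
    _ = _ := by ring

lemma const (c : ℂ) : PolyBound ε₀ 0 fun _ _ => c :=
  ⟨‖c‖, 0, norm_nonneg _, fun ε s _ _ _ => by simp⟩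

lemma const_mul (c : ℂ) (hf : PolyBound ε₀ j f) : PolyBound ε₀ j fun ε s => c * f ε s := by
  simpa using (const (ε₀ := ε₀) c).mul hf

lemma neg (hf : PolyBound ε₀ j f) : PolyBound ε₀ j fun ε s => -f ε s :=
  hf.of_le fun _ _ _ _ _ => (norm_neg _).le

lemma sub (hf : PolyBound ε₀ j f) (hg : PolyBound ε₀ j g) :
    PolyBound ε₀ j fun ε s => f ε s - g ε s :=
  (hf.add hg.neg).congr fun _ _ _ => sub_eq_add_neg _ _

lemma param : PolyBound ε₀ 1 fun ε _ => (ε : ℂ) :=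
  ⟨1, 0, zero_le_one, fun ε s h _ _ => by simp [abs_of_pos h]⟩

lemma pow (hf : PolyBound ε₀ j f) (n : ℕ) : PolyBound ε₀ (j * n) fun ε s => f ε s ^ n := by
  induction n with
  | zero => simpa using const (ε₀ := ε₀) 1
  | succ n ih => simpa only [pow_succ, Nat.mul_succ] using ih.mul hf

lemma div_pow (hf : PolyBound ε₀ (i + j) f) :
    PolyBound ε₀ i fun ε s => f ε s / (ε : ℂ) ^ j := by
  obtain ⟨C, k, hC, hb⟩ := hf
  refine ⟨C, k, hC, fun ε s h0 h1 h2 => ?_⟩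
  rw [norm_div, norm_pow, Complex.norm_real, Real.norm_of_nonneg h0.le,
    div_le_iff₀ (by positivity)]
  exact (hb ε s h0 h1 h2).trans (le_of_eq (by ring))

lemma contour : PolyBound ε₀ 0 fun _ s => airyPath (Real.pi / 3) s :=
  ⟨1, 1, zero_le_one, fun ε s _ _ _ => by simpa using norm_airyPath_le s⟩

end PolyBound

/-- `f ε s = f₀ s + ε f₁ s + O(ε²)`, with polynomially bounded coefficients and remainder. -/
structure FirstOrder (ε₀ : ℝ) (f : ℝ → ℝ → ℂ) (f₀ f₁ : ℝ → ℂ) : Prop where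
  zeroth : PolyBound ε₀ 0 fun _ s => f₀ s
  first : PolyBound ε₀ 0 fun _ s => f₁ s
  remainder : PolyBound ε₀ 2 fun ε s => f ε s - (f₀ s + ε * f₁ s)

namespace FirstOrder

variable {ε₀ : ℝ} {f g : ℝ → ℝ → ℂ} {f₀ f₁ g₀ g₁ : ℝ → ℂ}

lemma polynomial (hf : FirstOrder ε₀ f f₀ f₁) : PolyBound ε₀ 0 fun ε s => f₀ s + ε * f₁ s :=
  hf.zeroth.add ((PolyBound.param.mul hf.first).mono (Nat.zero_le _))

lemma polyBound (hf : FirstOrder ε₀ f f₀ f₁) : PolyBound ε₀ 0 f :=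
  ((hf.remainder.mono (Nat.zero_le _)).add hf.polynomial).congr fun ε s _ => by ring

lemma mul (hf : FirstOrder ε₀ f f₀ f₁) (hg : FirstOrder ε₀ g g₀ g₁) :
    FirstOrder ε₀ (fun ε s => f ε s * g ε s) (fun s => f₀ s * g₀ s)
      (fun s => f₀ s * g₁ s + f₁ s * g₀ s) where
  zeroth := hf.zeroth.mul hg.zeroth
  first := (hf.zeroth.mul hg.first).add (hf.first.mul hg.zeroth)
  remainder := by
    have h1 := hf.remainder.mul hg.polyBound
    have h2 := hf.polynomial.mul hg.remainder
    have h3 := (PolyBound.param (ε₀ := ε₀).pow 2).mul (hf.first.mul hg.first)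
    exact ((h1.add h2).add h3).congr fun ε s _ => by ring

end FirstOrder

/-- Second-order Taylor bound for an entire function on a disc. -/
lemma exists_norm_sub_taylor_le {F : ℂ → ℂ} (hF : Differentiable ℂ F) (ρ : ℝ) :
    ∃ C : ℝ, 0 ≤ C ∧ ∀ ζ : ℂ, ‖ζ‖ ≤ ρ →
      ‖F ζ - (F 1 + deriv F 1 * (ζ - 1))‖ ≤ C * ‖ζ - 1‖ ^ 2 := by
  have hd : ∀ f : ℂ → ℂ, Differentiable ℂ f → Differentiable ℂ (dslope f 1) := fun f hf =>
    differentiableOn_univ.1 ((Complex.differentiableOn_dslope univ_mem).2 hf.differentiableOn)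
  set h := dslope (dslope F 1) 1 with hh
  have hc : Continuous h := (hd _ (hd F hF)).continuous
  obtain ⟨C, hC⟩ := (isCompact_closedBall (0 : ℂ) ρ).exists_bound_of_continuousOn hc.continuousOn
  refine ⟨max C 0, le_max_right _ _, fun ζ hζ => ?_⟩
  have e1 := sub_smul_dslope F 1 ζ
  have e2 := sub_smul_dslope (dslope F 1) 1 ζ
  rw [dslope_same] at e2
  simp only [smul_eq_mul] at e1 e2
  have e3 : F ζ - (F 1 + deriv F 1 * (ζ - 1)) = h ζ * (ζ - 1) ^ 2 := by
    rw [hh]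
    linear_combination -e1 - (ζ - 1) * e2
  rw [e3, norm_mul, norm_pow]
  gcongr
  exact (hC ζ (by simpa using hζ)).trans (le_max_left _ _)

/-- The exponent of the rescaled integrand, normalised to vanish at the saddle. -/
noncomputable def phase (κ : ℝ) (τ : ℂ) (ε s : ℝ) : ℂ :=
  (1 - κ * ε * airyPath (Real.pi / 3) s + (κ * ε * airyPath (Real.pi / 3) s) ^ 2 / 2 -
      Complex.exp (-(κ * ε * airyPath (Real.pi / 3) s))) / (ε : ℂ) ^ 3 +
    τ * (Complex.exp (-(κ * ε * airyPath (Real.pi / 3) s)) - 1) / ε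

lemma scaled_airyPath_re_nonneg {κ ε : ℝ} (hκ : 0 ≤ κ) (hε : 0 ≤ ε) (s : ℝ) :
    0 ≤ ((κ : ℂ) * ε * airyPath (Real.pi / 3) s).re := by
  rw [← Complex.ofReal_mul, Complex.re_ofReal_mul]
  exact mul_nonneg (mul_nonneg hκ hε) (airyPath_re_pos s).le

lemma norm_scaled_airyPath {κ ε : ℝ} (hκ : 0 ≤ κ) (hε : 0 ≤ ε) (s : ℝ) :
    ‖(κ : ℂ) * ε * airyPath (Real.pi / 3) s‖ = κ * ε * ‖airyPath (Real.pi / 3) s‖ := by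
  rw [norm_mul, norm_mul, Complex.norm_real, Complex.norm_real, Real.norm_of_nonneg hκ,
    Real.norm_of_nonneg hε]

/-- Uniform Gaussian decay of the rescaled integrand on the whole contour. -/
lemma phase_re_le {κ : ℝ} (hκ : 1 ≤ κ) (hκ2 : κ ≤ 2) (hκ3 : κ ^ 3 = 2) (τ : ℂ) {ε : ℝ}
    (h0 : 0 < ε) (h1 : ε ≤ 1) (s : ℝ) :
    (phase κ τ ε s).re ≤ 1 + 2 * ‖τ‖ * (1 + |s|) - 1 / 12 * s ^ 2 := by
  unfold phase
  set T := airyPath (Real.pi / 3) s with hT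
  set v := (κ : ℂ) * ε * T with hv
  have hvre : 0 ≤ v.re := scaled_airyPath_re_nonneg (by linarith) h0.le s
  have hvn : ‖v‖ = κ * ε * ‖T‖ := norm_scaled_airyPath (by linarith) h0.le s
  have hTn : ‖T‖ ≤ 1 + |s| := norm_airyPath_le s
  have b2 : (τ * (Complex.exp (-v) - 1) / ε).re ≤ 2 * ‖τ‖ * (1 + |s|) := by
    refine (Complex.re_le_norm _).trans ?_
    have ht := norm_exp_neg_sub_sum_le hvre 1
    simp only [Finset.sum_range_one, pow_zero, Nat.factorial_zero, Nat.cast_one, div_one,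
      pow_one, Nat.factorial_one] at ht
    rw [norm_div, norm_mul, Complex.norm_real, Real.norm_of_nonneg h0.le, div_le_iff₀ h0]
    calc _ ≤ ‖τ‖ * (2 * ε * (1 + |s|)) := by
          gcongr
          refine ht.trans ?_
          rw [hvn]
          gcongr
      _ = _ := by ring
  have hcast : ∀ g : ℂ, (g / (ε : ℂ) ^ 3).re = g.re / ε ^ 3 := fun g => by
    rw [← Complex.ofReal_pow, Complex.div_ofReal_re]
  have b1 : ((1 - v + v ^ 2 / 2 - Complex.exp (-v)) / (ε : ℂ) ^ 3).re ≤ 1 - 1 / 12 * s ^ 2 := by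
    rw [hcast, div_le_iff₀ (by positivity)]
    rcases le_total 1 |s| with hs | hs
    · have hTn' : ‖T‖ = |s| := norm_airyPath_of_one_le hs
      set r := κ * ε * |s| with hr
      have hr0 : 0 ≤ r := by positivity
      have hvr : ‖v‖ = r := by rw [hvn, hTn']
      have hv1 : v.re = r / 2 := by
        rw [hv, ← Complex.ofReal_mul, Complex.re_ofReal_mul, hT, airyPath_re, max_eq_right hs, hr]
        ring
      have hv2 : (v ^ 2).re = -(r ^ 2 / 2) := by
        rw [hv, mul_pow, ← Complex.ofReal_mul, ← Complex.ofReal_pow, Complex.re_ofReal_mul, hT,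
          airyPath_sq_re hs, hr, ← sq_abs s]
        ring
      have hv3 : (v ^ 3).re = -r ^ 3 := by
        rw [hv, mul_pow, ← Complex.ofReal_mul, ← Complex.ofReal_pow, Complex.re_ofReal_mul, hT,
          airyPath_cube hs, Complex.ofReal_re, hr]
        ring
      have hs2 : s ^ 2 ≤ |s| ^ 3 := by
        rw [← sq_abs s]; exact pow_le_pow_right₀ hs (by norm_num)
      have hε3 : 0 < ε ^ 3 := by positivity
      suffices hmain : (1 - v + v ^ 2 / 2 - Complex.exp (-v)).re ≤ -(1 / 12 * s ^ 2) * ε ^ 3 by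
        nlinarith
      rcases le_total r 3 with h3 | h3
      · have ht := norm_exp_neg_sub_sum_le hvre 4
        have ht' := (Complex.abs_re_le_norm _).trans ht
        have e : (1 - v + v ^ 2 / 2 - Complex.exp (-v)).re = (v ^ 3).re / 6 -
            (Complex.exp (-v) - ∑ k ∈ Finset.range 4, (-v) ^ k / (k.factorial : ℂ)).re := by
          rw [show (v ^ 3).re / 6 = (v ^ 3 / 6).re by
            rw [show (6 : ℂ) = ((6 : ℝ) : ℂ) by simp, Complex.div_ofReal_re], ← Complex.sub_re]
          congr 1
          simp only [Finset.sum_range_succ, Finset.sum_range_zero, Nat.factorial]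
          push_cast
          ring
        have h4 := neg_abs_le (Complex.exp (-v) -
          ∑ k ∈ Finset.range 4, (-v) ^ k / (k.factorial : ℂ)).re
        rw [hvr, show ((Nat.factorial 4 : ℕ) : ℝ) = 24 by norm_num [Nat.factorial]] at ht'
        have hr3 : r ^ 3 = 2 * ε ^ 3 * |s| ^ 3 := by
          rw [hr, mul_pow, mul_pow, hκ3]
        have h5 : r ^ 4 ≤ 3 * r ^ 3 := by
          rw [pow_succ]; nlinarith [pow_nonneg hr0 3]
        rw [e, hv3]
        have h6 : s ^ 2 * ε ^ 3 ≤ |s| ^ 3 * ε ^ 3 := by gcongr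
        nlinarith
      · have he : ‖Complex.exp (-v)‖ ≤ 1 := by
          rw [Complex.norm_exp]; simpa using hvre
        have he' := (neg_abs_le (Complex.exp (-v)).re).trans le_rfl
        have he2 := (Complex.abs_re_le_norm (Complex.exp (-v))).trans he
        have e : (1 - v + v ^ 2 / 2 - Complex.exp (-v)).re =
            1 - v.re + (v ^ 2).re / 2 - (Complex.exp (-v)).re := by
          rw [show (v ^ 2).re / 2 = (v ^ 2 / 2).re by
            rw [show (2 : ℂ) = ((2 : ℝ) : ℂ) by simp, Complex.div_ofReal_re]]
          simp
        rw [e, hv1, hv2]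
        have h7 : ε ^ 2 * s ^ 2 ≤ r ^ 2 := by
          rw [hr, mul_pow, mul_pow, sq_abs]
          have : 1 ≤ κ ^ 2 := one_le_pow₀ hκ
          nlinarith [mul_nonneg (sq_nonneg ε) (sq_nonneg s)]
        have h8 : s ^ 2 * ε ^ 3 ≤ ε ^ 2 * s ^ 2 := by
          nlinarith [mul_nonneg (sq_nonneg ε) (sq_nonneg s)]
        nlinarith
    · have hTn' : ‖T‖ ≤ 1 := by
        have := norm_airyPath_le_max s
        rwa [max_eq_left hs] at this
      have ht := norm_exp_neg_sub_sum_le hvre 3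
      have e : 1 - v + v ^ 2 / 2 - Complex.exp (-v) =
          -(Complex.exp (-v) - ∑ k ∈ Finset.range 3, (-v) ^ k / (k.factorial : ℂ)) := by
        simp only [Finset.sum_range_succ, Finset.sum_range_zero, Nat.factorial]
        push_cast
        ring
      rw [← norm_neg, ← e] at ht
      refine (Complex.re_le_norm _).trans (ht.trans ?_)
      have h3 : ‖T‖ ^ 3 ≤ 1 := pow_le_one₀ (norm_nonneg _) hTn'
      rw [hvn, mul_pow, mul_pow, hκ3,
        show ((Nat.factorial 3 : ℕ) : ℝ) = 6 by norm_num [Nat.factorial]]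
      have h4 : s ^ 2 ≤ 1 := by rw [← sq_abs]; exact pow_le_one₀ (abs_nonneg s) hs
      have hε3 : 0 < ε ^ 3 := by positivity
      have h5 : ε ^ 3 * ‖T‖ ^ 3 ≤ ε ^ 3 := mul_le_of_le_one_right hε3.le h3
      nlinarith
  rw [Complex.add_re]
  linarith

lemma polyBound_scaled_airyPath (ε₀ κ : ℝ) :
    PolyBound ε₀ 1 fun ε s => (κ : ℂ) * ε * airyPath (Real.pi / 3) s :=
  (((PolyBound.const (κ : ℂ)).mul PolyBound.param).mul PolyBound.contour)

lemma polyBound_exp_taylor {ε₀ κ : ℝ} (hκ : 0 ≤ κ) (n : ℕ) :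
    PolyBound ε₀ n fun ε s => Complex.exp (-(κ * ε * airyPath (Real.pi / 3) s)) -
      ∑ k ∈ Finset.range n, (-(κ * ε * airyPath (Real.pi / 3) s)) ^ k / (k.factorial : ℂ) := by
  have h := (polyBound_scaled_airyPath ε₀ κ).pow n
  rw [one_mul] at h
  refine h.of_le fun ε s h0 _ _ => ?_
  refine (norm_exp_neg_sub_sum_le (scaled_airyPath_re_nonneg hκ h0.le s) n).trans ?_
  rw [norm_pow]
  exact div_le_self (by positivity) (by exact_mod_cast n.factorial_pos)

/-- The Gaussian weight dominating the rescaled integrand. -/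
noncomputable def airyWeight (τ : ℂ) (s : ℝ) : ℝ :=
  Real.exp (1 + 2 * ‖τ‖ * (1 + |s|) - 1 / 12 * s ^ 2)

lemma airyWeight_pos (τ : ℂ) (s : ℝ) : 0 < airyWeight τ s := Real.exp_pos _

/-- The Airy kernel divided by the weight. -/
noncomputable def airyRatio (κ : ℝ) (τ : ℂ) (s : ℝ) : ℂ :=
  Complex.exp (-(κ * τ) * airyPath (Real.pi / 3) s + (airyPath (Real.pi / 3) s) ^ 3 / 3) /
    airyWeight τ s

lemma norm_airyRatio_le_one {κ : ℝ} (hκ : 0 ≤ κ) (hκ2 : κ ≤ 2) (τ : ℂ) (s : ℝ) :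
    ‖airyRatio κ τ s‖ ≤ 1 := by
  rw [airyRatio, norm_div, Complex.norm_real, Real.norm_of_nonneg (airyWeight_pos τ s).le,
    div_le_one (airyWeight_pos τ s)]
  refine (norm_airy_exp_le _ s).trans (Real.exp_le_exp.2 ?_)
  have : ‖(κ : ℂ) * τ‖ ≤ 2 * ‖τ‖ := by
    rw [norm_mul, Complex.norm_real, Real.norm_of_nonneg hκ]
    gcongr
  gcongr

lemma norm_exp_phase_div_le_one {κ : ℝ} (hκ : 1 ≤ κ) (hκ2 : κ ≤ 2) (hκ3 : κ ^ 3 = 2) (τ : ℂ)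
    {ε : ℝ} (h0 : 0 < ε) (h1 : ε ≤ 1) (s : ℝ) :
    ‖Complex.exp (phase κ τ ε s) / airyWeight τ s‖ ≤ 1 := by
  rw [norm_div, Complex.norm_real, Real.norm_of_nonneg (airyWeight_pos τ s).le,
    div_le_one (airyWeight_pos τ s), Complex.norm_exp]
  exact Real.exp_le_exp.2 (phase_re_le hκ hκ2 hκ3 τ h0 h1 s)

/-- Expansion of the exponential factor. -/
lemma firstOrder_exp_phase (ε₀ : ℝ) {κ : ℝ} (hκ : 1 ≤ κ) (hκ2 : κ ≤ 2) (hκ3 : κ ^ 3 = 2) (τ : ℂ) :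
    FirstOrder ε₀ (fun ε s => Complex.exp (phase κ τ ε s) / airyWeight τ s)
      (airyRatio κ τ)
      (fun s => airyRatio κ τ s * (-(κ ^ 4 * airyPath (Real.pi / 3) s ^ 4 / 24) +
        τ * κ ^ 2 * airyPath (Real.pi / 3) s ^ 2 / 2)) := by
  have hκ0 : 0 ≤ κ := by linarith
  have hκ3' : (κ : ℂ) ^ 3 = 2 := by exact_mod_cast hκ3
  have hT : PolyBound ε₀ 0 fun _ s => airyPath (Real.pi / 3) s := PolyBound.contour
  have hratio : PolyBound ε₀ 0 fun _ s => airyRatio κ τ s :=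
    (PolyBound.const 1).of_le fun _ s _ _ _ => by
      simpa using norm_airyRatio_le_one hκ0 hκ2 τ s
  have hcoef : PolyBound ε₀ 0 fun _ s => -((κ : ℂ) ^ 4 * airyPath (Real.pi / 3) s ^ 4 / 24) +
      τ * κ ^ 2 * airyPath (Real.pi / 3) s ^ 2 / 2 :=
    (((hT.pow 4).const_mul (-(κ ^ 4 / 24))).add ((hT.pow 2).const_mul (τ * κ ^ 2 / 2))).congr
      fun _ _ _ => by ring
  set A : ℝ → ℂ := fun s =>
    -(κ * τ) * airyPath (Real.pi / 3) s + (airyPath (Real.pi / 3) s) ^ 3 / 3 with hA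
  have hR : PolyBound ε₀ 1 fun ε s => phase κ τ ε s - A s := by
    refine ((PolyBound.div_pow (i := 1) (j := 3)
      (polyBound_exp_taylor (ε₀ := ε₀) hκ0 4)).neg.add
        ((PolyBound.div_pow (i := 1) (j := 1)
          (polyBound_exp_taylor (ε₀ := ε₀) hκ0 2)).const_mul τ)).congr fun ε s h0 => ?_
    have hε : (ε : ℂ) ≠ 0 := by exact_mod_cast h0.ne'
    simp only [phase, hA, Finset.sum_range_succ, Finset.sum_range_zero, Nat.factorial]
    push_cast
    field_simp
    linear_combination (6 * (ε : ℂ) ^ 3 * airyPath (Real.pi / 3) s ^ 3) * hκ3'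
  have hR' : PolyBound ε₀ 2 fun ε s => phase κ τ ε s - A s -
      ε * (-(κ ^ 4 * airyPath (Real.pi / 3) s ^ 4 / 24) +
        τ * κ ^ 2 * airyPath (Real.pi / 3) s ^ 2 / 2) := by
    refine ((PolyBound.div_pow (i := 2) (j := 3)
      (polyBound_exp_taylor (ε₀ := ε₀) hκ0 5)).neg.add
        ((PolyBound.div_pow (i := 2) (j := 1)
          (polyBound_exp_taylor (ε₀ := ε₀) hκ0 3)).const_mul τ)).congr fun ε s h0 => ?_
    have hε : (ε : ℂ) ≠ 0 := by exact_mod_cast h0.ne'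
    simp only [phase, hA, Finset.sum_range_succ, Finset.sum_range_zero, Nat.factorial]
    push_cast
    field_simp
    linear_combination (144 * (ε : ℂ) ^ 3 * airyPath (Real.pi / 3) s ^ 3) * hκ3'
  have hquad : PolyBound ε₀ 2 fun ε s => Complex.exp (phase κ τ ε s) / airyWeight τ s -
      airyRatio κ τ s * (1 + (phase κ τ ε s - A s)) := by
    refine (hR.pow 2).of_le fun ε s h0 h1 _ => ?_
    set R := phase κ τ ε s - A s with hRdef
    have ht := norm_exp_sub_sum_le_max 2 R
    have he : Complex.exp (phase κ τ ε s) / airyWeight τ s =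
        airyRatio κ τ s * Complex.exp R := by
      rw [airyRatio, div_mul_eq_mul_div, ← Complex.exp_add, hRdef, hA]
      congr 2
      ring
    have hy := norm_exp_phase_div_le_one hκ hκ2 hκ3 τ h0 h1 s
    have ha := norm_airyRatio_le_one hκ0 hκ2 τ s
    rw [he, norm_mul, Complex.norm_exp] at hy
    rw [he, ← mul_sub, norm_mul, norm_pow]
    have e : Complex.exp R - (1 + R) =
        Complex.exp R - ∑ k ∈ Finset.range 2, R ^ k / (k.factorial : ℂ) := by
      simp [Finset.sum_range_succ]
    rw [e]
    calc _ ≤ ‖airyRatio κ τ s‖ * (‖R‖ ^ 2 / (Nat.factorial 2 : ℕ) * max 1 (Real.exp R.re)) := by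
          gcongr
      _ = ‖R‖ ^ 2 / 2 * max (‖airyRatio κ τ s‖ * 1) (‖airyRatio κ τ s‖ * Real.exp R.re) := by
          rw [← mul_max_of_nonneg _ _ (norm_nonneg _), Nat.factorial_two]
          push_cast
          ring
      _ ≤ ‖R‖ ^ 2 / 2 * 1 := by
          gcongr
          exact max_le (by simpa using ha) hy
      _ ≤ ‖R‖ ^ 2 := by linarith [sq_nonneg ‖R‖]
  refine ⟨hratio, hratio.mul hcoef, ?_⟩
  have h := hquad.add (hratio.mul hR')
  exact h.congr fun ε s _ => by ring

/-- Expansion of the linear prefactor. -/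
lemma firstOrder_prefactor {ε₀ κ : ℝ} (hκ : 0 ≤ κ) (τ : ℂ) {ω : ℝ → ℂ} {K : ℝ} (hK : 0 ≤ K)
    (hω : ∀ ε, 0 < ε → ε ≤ ε₀ → ‖ω ε‖ ≤ K * ε ^ 3) :
    FirstOrder ε₀ (fun ε s => (1 - (1 - τ * ε ^ 2) * (1 + ω ε) *
        Complex.exp (-(κ * ε * airyPath (Real.pi / 3) s))) / ε)
      (fun s => κ * airyPath (Real.pi / 3) s)
      (fun s => τ - κ ^ 2 * airyPath (Real.pi / 3) s ^ 2 / 2) := by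
  have hT : PolyBound ε₀ 0 fun _ s => airyPath (Real.pi / 3) s := PolyBound.contour
  have hωb : PolyBound ε₀ 3 fun ε _ => ω ε :=
    ⟨K, 0, hK, fun ε s h0 _ h2 => by simpa using hω ε h0 h2⟩
  refine ⟨hT.const_mul κ, ((PolyBound.const τ).sub
    ((hT.pow 2).const_mul (κ ^ 2 / 2))).congr fun _ _ _ => by ring, ?_⟩
  have hε2 : PolyBound ε₀ 2 fun ε _ => (ε : ℂ) ^ 2 := by
    simpa using (PolyBound.param (ε₀ := ε₀)).pow 2
  have h1 := (polyBound_exp_taylor (ε₀ := ε₀) hκ 3).neg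
  have h2 := (hε2.mul (polyBound_exp_taylor (ε₀ := ε₀) hκ 1)).const_mul τ
  have h3 := (hωb.mul ((PolyBound.const (ε₀ := ε₀) 1).sub
    ((hε2.const_mul τ).mono (Nat.zero_le _)))).mul (polyBound_exp_taylor (ε₀ := ε₀) hκ 0)
  refine (PolyBound.div_pow (i := 2) (j := 1) ((h1.add h2).sub h3)).congr fun ε s h0 => ?_
  have hε : (ε : ℂ) ≠ 0 := by exact_mod_cast h0.ne'
  simp only [Finset.sum_range_succ, Finset.sum_range_zero, Nat.factorial]
  push_cast
  field_simp
  ring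

/-- Expansion of the analytic factor. -/
lemma firstOrder_analytic {ε₀ κ : ℝ} (hκ : 0 ≤ κ) (τ : ℂ) {ω : ℝ → ℂ} {K : ℝ} (hK : 0 ≤ K)
    (hω : ∀ ε, 0 < ε → ε ≤ ε₀ → ‖ω ε‖ ≤ K * ε ^ 3) {F : ℂ → ℂ} (hF : Differentiable ℂ F) :
    FirstOrder ε₀ (fun ε s => F ((1 - τ * ε ^ 2) * (1 + ω ε) *
        Complex.exp (-(κ * ε * airyPath (Real.pi / 3) s))))
      (fun _ => F 1)
      (fun s => -(deriv F 1 * (κ * airyPath (Real.pi / 3) s))) := by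
  have hL := firstOrder_prefactor hκ τ hK hω
  have hT : PolyBound ε₀ 0 fun _ s => airyPath (Real.pi / 3) s := PolyBound.contour
  obtain ⟨C, hC, hCb⟩ := exists_norm_sub_taylor_le hF ((1 + ‖τ‖) * (1 + K))
  refine ⟨PolyBound.const _, ((hT.const_mul κ).const_mul (deriv F 1)).neg, ?_⟩
  set ζ : ℝ → ℝ → ℂ := fun ε s => (1 - τ * ε ^ 2) * (1 + ω ε) *
    Complex.exp (-(κ * ε * airyPath (Real.pi / 3) s)) with hζ
  set L : ℝ → ℝ → ℂ := fun ε s => (1 - ζ ε s) / ε with hLdef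
  have hLb : PolyBound ε₀ 0 L := hL.polyBound
  have hζL : ∀ ε s : ℝ, 0 < ε → ζ ε s - 1 = -(ε * L ε s) := fun ε s h0 => by
    have hε : (ε : ℂ) ≠ 0 := by exact_mod_cast h0.ne'
    simp only [hLdef]
    field_simp
    ring
  have hεL : PolyBound ε₀ 1 fun ε s => ε * L ε s := by
    simpa using PolyBound.param.mul hLb
  have hrem : PolyBound ε₀ 2 fun ε s => F (ζ ε s) - (F 1 + deriv F 1 * (ζ ε s - 1)) := by
    refine ((hεL.pow 2).const_mul (C : ℂ)).of_le fun ε s h0 h1 h2 => ?_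
    refine (hCb _ ?_).trans ?_
    · simp only [hζ]
      rw [norm_mul, norm_mul]
      have e1 : ‖1 - τ * (ε : ℂ) ^ 2‖ ≤ 1 + ‖τ‖ := by
        refine (norm_sub_le _ _).trans ?_
        rw [norm_one, norm_mul, norm_pow, Complex.norm_real, Real.norm_of_nonneg h0.le]
        gcongr
        exact mul_le_of_le_one_right (norm_nonneg _) (pow_le_one₀ h0.le h1)
      have e2 : ‖1 + ω ε‖ ≤ 1 + K := by
        refine (norm_add_le _ _).trans ?_
        rw [norm_one]
        gcongr
        exact (hω ε h0 h2).trans (mul_le_of_le_one_right hK (pow_le_one₀ h0.le h1))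
      have e3 : ‖Complex.exp (-(κ * ε * airyPath (Real.pi / 3) s))‖ ≤ 1 := by
        rw [Complex.norm_exp]
        simpa using scaled_airyPath_re_nonneg hκ h0.le s
      calc _ ≤ (1 + ‖τ‖) * (1 + K) * 1 := by gcongr
        _ = _ := mul_one _
    · rw [hζL ε s h0, norm_neg, norm_mul (C : ℂ), norm_pow, Complex.norm_real,
        Real.norm_of_nonneg hC]
  have hL1 : PolyBound ε₀ 1 fun ε s => L ε s - κ * airyPath (Real.pi / 3) s :=
    ((hL.remainder.mono (i := 1) (by norm_num)).add (PolyBound.param.mul hL.first)).congr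
      fun ε s _ => by ring
  refine (hrem.sub ((PolyBound.param.mul hL1).const_mul (deriv F 1))).congr fun ε s h0 => ?_
  rw [hζL ε s h0]
  ring

/-- The zeroth and first order coefficients of the rescaled integrand, without the Airy kernel. -/
lemma firstOrder_integrand {ε₀ κ : ℝ} (hκ : 1 ≤ κ) (hκ2 : κ ≤ 2) (hκ3 : κ ^ 3 = 2) (τ : ℂ)
    {ω : ℝ → ℂ} {K : ℝ} (hK : 0 ≤ K) (hω : ∀ ε, 0 < ε → ε ≤ ε₀ → ‖ω ε‖ ≤ K * ε ^ 3)
    {F : ℂ → ℂ} (hF : Differentiable ℂ F) :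
    FirstOrder ε₀ (fun ε s => Complex.exp (phase κ τ ε s) / airyWeight τ s *
        ((1 - (1 - τ * ε ^ 2) * (1 + ω ε) *
          Complex.exp (-(κ * ε * airyPath (Real.pi / 3) s))) / ε *
        F ((1 - τ * ε ^ 2) * (1 + ω ε) * Complex.exp (-(κ * ε * airyPath (Real.pi / 3) s)))))
      (fun s => airyRatio κ τ s * (κ * airyPath (Real.pi / 3) s * F 1))
      (fun s => airyRatio κ τ s * (κ * airyPath (Real.pi / 3) s *
            -(deriv F 1 * (κ * airyPath (Real.pi / 3) s)) +
          (τ - κ ^ 2 * airyPath (Real.pi / 3) s ^ 2 / 2) * F 1) +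
        airyRatio κ τ s * (-(κ ^ 4 * airyPath (Real.pi / 3) s ^ 4 / 24) +
          τ * κ ^ 2 * airyPath (Real.pi / 3) s ^ 2 / 2) *
          (κ * airyPath (Real.pi / 3) s * F 1)) :=
  (firstOrder_exp_phase ε₀ hκ hκ2 hκ3 τ).mul
    ((firstOrder_prefactor (by linarith) τ hK hω).mul
      (firstOrder_analytic (by linarith) τ hK hω hF))

/-- The rescaled integrand on the Airy contour. -/
noncomputable def rescaledIntegrand (κ : ℝ) (τ : ℂ) (ω : ℝ → ℂ) (F : ℂ → ℂ) (ε s : ℝ) : ℂ :=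
  Complex.exp (phase κ τ ε s) *
    ((1 - (1 - τ * ε ^ 2) * (1 + ω ε) *
      Complex.exp (-(κ * ε * airyPath (Real.pi / 3) s))) / ε *
    F ((1 - τ * ε ^ 2) * (1 + ω ε) * Complex.exp (-(κ * ε * airyPath (Real.pi / 3) s)))) *
    airyPathDeriv (Real.pi / 3) s

lemma aestronglyMeasurable_rescaledIntegrand (κ : ℝ) (τ : ℂ) (ω : ℝ → ℂ) {F : ℂ → ℂ}
    (hF : Continuous F) (ε : ℝ) :
    AEStronglyMeasurable fun s => rescaledIntegrand κ τ ω F ε s := by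
  have := continuous_airyPath
  refine (Continuous.aestronglyMeasurable ?_).mul measurable_airyPathDeriv.aestronglyMeasurable
  unfold phase
  fun_prop

lemma integrable_of_norm_le_airyWeight {τ : ℂ} {f : ℝ → ℂ} (hf : AEStronglyMeasurable f) {C : ℝ}
    {k : ℕ} (h : ∀ s, ‖f s‖ ≤ C * (1 + |s|) ^ k * airyWeight τ s) : Integrable f := by
  refine ((integrable_pow_mul_exp_sub_sq k 1 (2 * ‖τ‖) (c := 1 / 12)
    (by norm_num)).const_mul C).mono' hf (ae_of_all _ fun s => ?_)
  rw [← mul_assoc]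
  exact h s

lemma integrable_rescaledIntegrand {ε₀ κ : ℝ} (hκ : 1 ≤ κ) (hκ2 : κ ≤ 2) (hκ3 : κ ^ 3 = 2) (τ : ℂ)
    {ω : ℝ → ℂ} {K : ℝ} (hK : 0 ≤ K) (hω : ∀ ε, 0 < ε → ε ≤ ε₀ → ‖ω ε‖ ≤ K * ε ^ 3)
    {F : ℂ → ℂ} (hF : Differentiable ℂ F) {ε : ℝ} (h0 : 0 < ε) (h1 : ε ≤ 1) (h2 : ε ≤ ε₀) :
    Integrable fun s => rescaledIntegrand κ τ ω F ε s := by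
  obtain ⟨C, k, hC, hb⟩ := (firstOrder_integrand hκ hκ2 hκ3 τ hK hω hF).polyBound
  refine integrable_of_norm_le_airyWeight (τ := τ) (C := C) (k := k)
    (aestronglyMeasurable_rescaledIntegrand κ τ ω hF.continuous ε) fun s => ?_
  refine (norm_mul_airyPathDeriv_le _ s).trans ?_
  have h := hb ε s h0 h1 h2
  beta_reduce at h
  rw [div_mul_eq_mul_div, norm_div, Complex.norm_real,
    Real.norm_of_nonneg (airyWeight_pos τ s).le, div_le_iff₀ (airyWeight_pos τ s),
    pow_zero, mul_one] at h
  exact h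

/-- Two-term asymptotics of the rescaled integral in terms of Airy moments. -/
lemma exists_norm_integral_rescaledIntegrand_sub_le {ε₀ κ : ℝ} (hκ : 1 ≤ κ) (hκ2 : κ ≤ 2)
    (hκ3 : κ ^ 3 = 2) (τ : ℂ)
    {ω : ℝ → ℂ} {K : ℝ} (hK : 0 ≤ K) (hω : ∀ ε, 0 < ε → ε ≤ ε₀ → ‖ω ε‖ ≤ K * ε ^ 3)
    {F : ℂ → ℂ} (hF : Differentiable ℂ F) :
    ∃ C : ℝ, ∀ ε, 0 < ε → ε ≤ 1 → ε ≤ ε₀ →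
      ‖(∫ s, rescaledIntegrand κ τ ω F ε s) - (κ * F 1 * airyMoment (κ * τ) 1 +
        ε * (τ * F 1 * airyMoment (κ * τ) 0 -
          (κ ^ 2 * deriv F 1 + κ ^ 2 / 2 * F 1) * airyMoment (κ * τ) 2 +
          τ * κ ^ 3 / 2 * F 1 * airyMoment (κ * τ) 3 -
          κ ^ 5 / 24 * F 1 * airyMoment (κ * τ) 5))‖ ≤ C * ε ^ 2 := by
  obtain ⟨C, k, hC, hb⟩ := (firstOrder_integrand hκ hκ2 hκ3 τ hK hω hF).remainder
  set D : ℝ := ∫ s : ℝ, (1 + |s|) ^ k * airyWeight τ s with hD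
  have hDint : Integrable fun s : ℝ => (1 + |s|) ^ k * airyWeight τ s :=
    integrable_pow_mul_exp_sub_sq k 1 (2 * ‖τ‖) (by norm_num)
  refine ⟨C * D, fun ε h0 h1 h2 => ?_⟩
  set m : ℕ → ℝ → ℂ := fun j s =>
    Complex.exp (-(κ * τ) * airyPath (Real.pi / 3) s + (airyPath (Real.pi / 3) s) ^ 3 / 3) *
      (airyPath (Real.pi / 3) s) ^ j * airyPathDeriv (Real.pi / 3) s with hm
  have im : ∀ j, Integrable (m j) := fun j => integrable_airyMoment_integrand _ j
  have em : ∀ (a : ℂ) j, ∫ s, a * m j s = a * airyMoment (κ * τ) j := fun a j =>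
    integral_const_mul _ _
  set a1 : ℂ := κ * F 1
  set b0 : ℂ := ε * (τ * F 1)
  set b2 : ℂ := -ε * (κ ^ 2 * deriv F 1 + κ ^ 2 / 2 * F 1)
  set b3 : ℂ := ε * (τ * κ ^ 3 / 2 * F 1)
  set b5 : ℂ := -ε * (κ ^ 5 / 24 * F 1)
  have i1 := (im 1).const_mul a1
  have i2 := i1.add ((im 0).const_mul b0)
  have i3 := i2.add ((im 2).const_mul b2)
  have i4 := i3.add ((im 3).const_mul b3)
  have i5 := i4.add ((im 5).const_mul b5)
  have hI := integrable_rescaledIntegrand hκ hκ2 hκ3 τ hK hω hF h0 h1 h2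
  have hsum : ∫ s, (a1 * m 1 s + b0 * m 0 s + b2 * m 2 s + b3 * m 3 s + b5 * m 5 s) =
      a1 * airyMoment (κ * τ) 1 + b0 * airyMoment (κ * τ) 0 + b2 * airyMoment (κ * τ) 2 +
        b3 * airyMoment (κ * τ) 3 + b5 * airyMoment (κ * τ) 5 := by
    simp only [← em]
    refine (integral_add i4 ((im 5).const_mul b5)).trans (congrArg (· + _) ?_)
    refine (integral_add i3 ((im 3).const_mul b3)).trans (congrArg (· + _) ?_)
    refine (integral_add i2 ((im 2).const_mul b2)).trans (congrArg (· + _) ?_)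
    exact integral_add i1 ((im 0).const_mul b0)
  have hdiff := integral_sub hI i5
  have htarget : (∫ s, rescaledIntegrand κ τ ω F ε s) - (κ * F 1 * airyMoment (κ * τ) 1 +
        ε * (τ * F 1 * airyMoment (κ * τ) 0 -
          (κ ^ 2 * deriv F 1 + κ ^ 2 / 2 * F 1) * airyMoment (κ * τ) 2 +
          τ * κ ^ 3 / 2 * F 1 * airyMoment (κ * τ) 3 -
          κ ^ 5 / 24 * F 1 * airyMoment (κ * τ) 5)) =
      ∫ s, (rescaledIntegrand κ τ ω F ε s -
        (a1 * m 1 s + b0 * m 0 s + b2 * m 2 s + b3 * m 3 s + b5 * m 5 s)) := by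
    refine Eq.trans ?_ hdiff.symm
    refine congrArg _ (Eq.trans ?_ hsum.symm)
    ring
  rw [htarget]
  calc _ ≤ ∫ s, C * ε ^ 2 * ((1 + |s|) ^ k * airyWeight τ s) := by
        refine norm_integral_le_of_norm_le (hDint.const_mul _) (ae_of_all _ fun s => ?_)
        have hw : ((airyWeight τ s : ℝ) : ℂ) ≠ 0 := by exact_mod_cast (airyWeight_pos τ s).ne'
        have h := hb ε s h0 h1 h2
        have hwn : ‖((airyWeight τ s : ℝ) : ℂ)‖ = airyWeight τ s := by
          rw [Complex.norm_real, Real.norm_of_nonneg (airyWeight_pos τ s).le]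
        have h' := mul_le_mul_of_nonneg_right h (airyWeight_pos τ s).le
        nth_rewrite 1 [← hwn] at h'
        rw [← norm_mul] at h'
        refine le_trans ?_ (h'.trans (le_of_eq (mul_assoc _ _ _)))
        refine le_trans (le_of_eq ?_) (norm_mul_airyPathDeriv_le _ s)
        congr 1
        simp only [rescaledIntegrand, airyRatio, hm]
        field_simp
        ring
    _ = _ := by rw [integral_const_mul]; ring

/-- The integrand of `φ_1` in the variable `v = 1 + ix`. -/
noncomputable def contourIntegrand (a c : ℂ) (w : ℝ) (F : ℂ → ℂ) (v : ℂ) : ℂ :=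
  (1 - c * Complex.exp (-v)) *
    Complex.exp ((1 - v) ^ 2 / (2 * w) - a / w * Complex.exp (-v)) * F (c * Complex.exp (-v))

lemma differentiable_contourIntegrand (a c : ℂ) (w : ℝ) {F : ℂ → ℂ} (hF : Differentiable ℂ F) :
    Differentiable ℂ (contourIntegrand a c w F) := by
  unfold contourIntegrand
  fun_prop

lemma exists_norm_contourIntegrand_le (a c : ℂ) (w : ℝ) {F : ℂ → ℂ} (hF : Continuous F) :
    ∃ C, ∀ v : ℂ, 0 ≤ v.re →
      ‖contourIntegrand a c w F v‖ ≤ C * Real.exp (1 / (2 * w) * ((1 - v) ^ 2).re) := by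
  obtain ⟨B, hB⟩ := (isCompact_closedBall (0 : ℂ) ‖c‖).exists_bound_of_continuousOn hF.continuousOn
  refine ⟨(1 + ‖c‖) * Real.exp ‖a / w‖ * B, fun v hv => ?_⟩
  have he : ‖Complex.exp (-v)‖ ≤ 1 := by
    rw [Complex.norm_exp]
    simpa using hv
  have hc : ‖c * Complex.exp (-v)‖ ≤ ‖c‖ := by
    rw [norm_mul]
    exact mul_le_of_le_one_right (norm_nonneg _) he
  have h1 : ‖1 - c * Complex.exp (-v)‖ ≤ 1 + ‖c‖ := by
    refine (norm_sub_le _ _).trans ?_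
    rw [norm_one]
    gcongr
  have h2 : ‖F (c * Complex.exp (-v))‖ ≤ B := hB _ (by simpa using hc)
  have h3 : ‖Complex.exp ((1 - v) ^ 2 / (2 * w) - a / w * Complex.exp (-v))‖ ≤
      Real.exp ‖a / w‖ * Real.exp (1 / (2 * w) * ((1 - v) ^ 2).re) := by
    rw [Complex.norm_exp, ← Real.exp_add]
    refine Real.exp_le_exp.2 ?_
    have e1 : ((1 - v) ^ 2 / (2 * w)).re = 1 / (2 * w) * ((1 - v) ^ 2).re := by
      rw [show (1 - v) ^ 2 / (2 * (w : ℂ)) = ((1 / (2 * w) : ℝ) : ℂ) * (1 - v) ^ 2 by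
        push_cast; ring, Complex.re_ofReal_mul]
    have e2 : -(a / w * Complex.exp (-v)).re ≤ ‖a / w‖ := by
      refine (neg_le_abs _).trans ((Complex.abs_re_le_norm _).trans ?_)
      rw [norm_mul]
      exact mul_le_of_le_one_right (norm_nonneg _) he
    rw [Complex.sub_re, e1]
    linarith
  rw [contourIntegrand, norm_mul, norm_mul]
  calc _ ≤ (1 + ‖c‖) * (Real.exp ‖a / w‖ * Real.exp (1 / (2 * w) * ((1 - v) ^ 2).re)) * B := by
        gcongr
    _ = _ := by ring

lemma phiR_one_eq_integral_contourIntegrand (a : ℂ) {w : ℝ} (hw : 0 < w) (wp : ℝ) (F : ℂ → ℂ) :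
    phiR 1 (a / ((Real.exp 1 * w : ℝ) : ℂ)) w wp F = 1 / (Real.sqrt (2 * Real.pi * w) : ℂ) *
      ∫ x : ℝ, contourIntegrand a (a * (wp / w)) w F (1 + x * Complex.I) := by
  rw [phiR]
  refine congrArg _ (integral_congr_ae (ae_of_all _ fun x => ?_))
  have hw' : (w : ℂ) ≠ 0 := by exact_mod_cast hw.ne'
  have he : Complex.exp (-(1 + x * Complex.I)) =
      Complex.exp (-Complex.I * x) / Complex.exp 1 := by
    rw [← Complex.exp_sub]
    ring_nf
  have he1 := Complex.exp_ne_zero 1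
  have h1 : a / ((Real.exp 1 * w : ℝ) : ℂ) * wp * Complex.exp (-Complex.I * x) =
      a * (wp / w) * Complex.exp (-(1 + x * Complex.I)) := by
    rw [he]
    push_cast
    field_simp
  have h2 : a / ((Real.exp 1 * w : ℝ) : ℂ) * Complex.exp (-Complex.I * x) =
      a / w * Complex.exp (-(1 + x * Complex.I)) := by
    rw [he]
    push_cast
    field_simp
  have h3 : (1 - (1 + x * Complex.I)) ^ 2 = -(x : ℂ) ^ 2 := by
    ring_nf
    rw [Complex.I_sq]
    ring
  simp only [zpow_one, contourIntegrand, h1, h2, h3]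

lemma contourIntegrand_mul_airyPathDeriv {ε : ℝ} (h0 : 0 < ε) (κ : ℝ) (τ : ℂ) (ω : ℝ → ℂ)
    (F : ℂ → ℂ) (s : ℝ) :
    contourIntegrand (1 - τ * ε ^ 2) ((1 - τ * ε ^ 2) * (1 + ω ε)) (ε ^ 3) F
        (((κ * ε : ℝ) : ℂ) * airyPath (Real.pi / 3) s) * airyPathDeriv (Real.pi / 3) s =
      ε * Complex.exp (-1 / (2 * ε ^ 3) + τ / ε) * rescaledIntegrand κ τ ω F ε s := by
  have hε : (ε : ℂ) ≠ 0 := by exact_mod_cast h0.ne'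
  rw [contourIntegrand, rescaledIntegrand]
  push_cast
  set T := airyPath (Real.pi / 3) s with hT
  have h : Complex.exp ((1 - κ * ε * T) ^ 2 / (2 * ε ^ 3) -
        (1 - τ * ε ^ 2) / ε ^ 3 * Complex.exp (-(κ * ε * T))) =
      Complex.exp (-1 / (2 * ε ^ 3) + τ / ε) * Complex.exp (phase κ τ ε s) := by
    rw [← Complex.exp_add, phase, ← hT]
    congr 1
    field_simp
    ring
  rw [h]
  field_simp

/-- The integral `φ_1` as a rescaled integral over the Airy contour. -/
lemma phiR_one_mul_I_eq {ε κ wp : ℝ} (h0 : 0 < ε) (hκ : 0 < κ) (τ : ℂ) {ω : ℝ → ℂ}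
    (hω : 1 + ω ε = wp / (ε : ℂ) ^ 3) {F : ℂ → ℂ} (hF : Differentiable ℂ F)
    (hi : Integrable fun s => rescaledIntegrand κ τ ω F ε s) :
    phiR 1 ((1 - τ * ε ^ 2) / ((Real.exp 1 * ε ^ 3 : ℝ) : ℂ)) (ε ^ 3) wp F * Complex.I =
      1 / (Real.sqrt (2 * Real.pi * ε ^ 3) : ℂ) * (κ * ε ^ 2 *
        Complex.exp (-1 / (2 * ε ^ 3) + τ / ε) * ∫ s, rescaledIntegrand κ τ ω F ε s) := by
  obtain ⟨C, hC⟩ := exists_norm_contourIntegrand_le (1 - τ * ε ^ 2)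
    ((1 - τ * ε ^ 2) * (1 + ω ε)) (ε ^ 3) hF.continuous
  have hε3 : 0 < ε ^ 3 := by positivity
  rw [phiR_one_eq_integral_contourIntegrand _ hε3, mul_assoc, ← integral_mul_const]
  push_cast
  rw [← hω, integral_vertical_eq_integral_airyPath (differentiable_contourIntegrand _ _ _ hF)
    (mul_pos hκ h0) (by positivity) hC]
  · simp only [contourIntegrand_mul_airyPathDeriv h0]
    rw [integral_mul_const, integral_const_mul]
    push_cast
    ring
  · simp only [contourIntegrand_mul_airyPathDeriv h0]
    exact hi.const_mul _

/-- The two-term coefficient in terms of the Airy function and its derivative. -/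
lemma airyMoment_coefficient_eq {κ : ℝ} (hκ3 : κ ^ 3 = 2) (τ f f' : ℂ) :
    τ * f * airyMoment (κ * τ) 0 - (κ ^ 2 * f' + κ ^ 2 / 2 * f) * airyMoment (κ * τ) 2 +
        τ * κ ^ 3 / 2 * f * airyMoment (κ * τ) 3 - κ ^ 5 / 24 * f * airyMoment (κ * τ) 5 =
      -(2 * Real.pi * Complex.I * κ) * (1 / 3 * (f + 6 * f') * (κ : ℂ)⁻¹ * τ * airyAi (κ * τ) +
        5 / 6 * f * τ ^ 2 * airyAi' (κ * τ)) := by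
  have h3 : (κ : ℂ) ^ 3 = 2 := by exact_mod_cast hκ3
  have hκ : (κ : ℂ) ≠ 0 := by
    rintro h
    simp [h] at h3
  have hpi : (Real.pi : ℂ) ≠ 0 := by exact_mod_cast Real.pi_ne_zero
  have hm2 := airyMoment_add_two (κ * τ) 0
  have hm3 := airyMoment_add_two (κ * τ) 1
  have hm5 := airyMoment_add_two (κ * τ) 3
  norm_num at hm2 hm3 hm5
  rw [hm5, hm3, hm2, airyAi_eq_airyMoment, airyAi'_eq_airyMoment]
  field_simp
  rw [show (κ : ℂ) ^ 6 = (κ ^ 3) ^ 2 by ring, h3]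
  ring

/-- Refined part (c) estimate for `φ_1`: with `z(w) = (1 − τw^{2/3})/(ew)`,
`φ_1 = −√(2π) 2^{2/3} w^{1/6} K_1(τ,w) e^{−1/(2w) + τ/w^{1/3}}` where
`K_1(τ,w) = F(1)Ai'(2^{1/3}τ) + w^{1/3}((1/3)(F(1) + 6F'(1))2^{−1/3}τAi(2^{1/3}τ)
+ (5/6)F(1)τ²Ai'(2^{1/3}τ)) + O(w^{2/3})`. -/
theorem phiR1_refined_part_c (F : ℂ → ℂ) (hF : Differentiable ℂ F)
    (hFne : ∀ x : ℂ, x ≠ 0 → F x ≠ 0)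
    (W : ℝ → ℝ) (hW : (fun w => W w - w) =O[𝓝[>] (0 : ℝ)] fun w => w ^ 2)
    (τ : ℂ) :
    ∃ E : ℝ → ℂ,
      (E =O[𝓝[>] (0 : ℝ)] fun w => w ^ ((2 : ℝ) / 3)) ∧
      ∀ᶠ w in 𝓝[>] (0 : ℝ),
        phiR 1 ((1 - τ * ((w ^ ((2 : ℝ) / 3) : ℝ) : ℂ)) / ((Real.exp 1 * w : ℝ) : ℂ))
            w (W w) F =
          -((Real.sqrt (2 * Real.pi) : ℂ) * (2 : ℂ) ^ ((2 : ℂ) / 3) *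
            ((w ^ ((1 : ℝ) / 6) : ℝ) : ℂ) *
            (F 1 * airyAi' ((2 : ℂ) ^ ((1 : ℂ) / 3) * τ)
              + ((w ^ ((1 : ℝ) / 3) : ℝ) : ℂ) *
                ((1 / 3 : ℂ) * (F 1 + 6 * deriv F 1) * (2 : ℂ) ^ (-(1 : ℂ) / 3) * τ *
                    airyAi ((2 : ℂ) ^ ((1 : ℂ) / 3) * τ)
                  + (5 / 6 : ℂ) * F 1 * τ ^ 2 * airyAi' ((2 : ℂ) ^ ((1 : ℂ) / 3) * τ))
              + E w) *
            Complex.exp (-1 / (2 * (w : ℂ)) + τ / ((w ^ ((1 : ℝ) / 3) : ℝ) : ℂ))) := by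
  obtain ⟨K, hK, hKW⟩ := hW.exists_pos
  obtain ⟨δ, hδ, hδW⟩ := mem_nhdsGT_iff_exists_Ioo_subset.1 hKW.bound
  rw [Set.mem_Ioi] at hδ
  set κ : ℝ := (2 : ℝ) ^ ((1 : ℝ) / 3) with hκdef
  have hκ3 : κ ^ 3 = 2 := by
    rw [hκdef, ← Real.rpow_natCast, ← Real.rpow_mul (by norm_num)]
    norm_num
  have hκ1 : 1 ≤ κ := Real.one_le_rpow (by norm_num) (by norm_num)
  have hκ2 : κ ≤ 2 := by nlinarith [sq_nonneg κ]
  have hκ0 : 0 < κ := by linarith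
  have hκc : (κ : ℂ) ≠ 0 := by exact_mod_cast hκ0.ne'
  have hκ_one : (2 : ℂ) ^ ((1 : ℂ) / 3) = κ := by
    rw [hκdef, Complex.ofReal_cpow (by norm_num)]
    norm_num
  have hκ_two : (2 : ℂ) ^ ((2 : ℂ) / 3) = (κ : ℂ) ^ 2 := by
    rw [← hκ_one, ← Complex.cpow_nat_mul]
    norm_num
  have hκ_neg : (2 : ℂ) ^ (-(1 : ℂ) / 3) = (κ : ℂ)⁻¹ := by
    rw [neg_div, Complex.cpow_neg, hκ_one]
  set ω : ℝ → ℂ := fun ε => W (ε ^ 3) / (ε : ℂ) ^ 3 - 1 with hωdef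
  set ε₀ : ℝ := min 1 (δ / 2) with hε₀
  have hω : ∀ ε, 0 < ε → ε ≤ ε₀ → ‖ω ε‖ ≤ K * ε ^ 3 := by
    intro ε h0 h1
    have hε3 : 0 < ε ^ 3 := by positivity
    have hle : ε ^ 3 ≤ ε := pow_le_of_le_one h0.le (h1.trans (min_le_left _ _)) (by norm_num)
    have hlt : ε ^ 3 < δ := by linarith [h1.trans (min_le_right _ _)]
    have h := hδW ⟨hε3, hlt⟩
    simp only [Set.mem_ofPred_eq, norm_pow, Real.norm_of_nonneg hε3.le] at h
    have hform : ω ε = (((W (ε ^ 3) - ε ^ 3) / ε ^ 3 : ℝ) : ℂ) := by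
      have : (ε : ℂ) ≠ 0 := by exact_mod_cast h0.ne'
      rw [hωdef]
      push_cast
      field_simp
    rw [hform, Complex.norm_real, norm_div, Real.norm_of_nonneg hε3.le, div_le_iff₀ hε3]
    exact h.trans (le_of_eq (by ring))
  obtain ⟨C, hC⟩ := exists_norm_integral_rescaledIntegrand_sub_le hκ1 hκ2 hκ3 τ hK.le hω hF
  set J : ℝ → ℂ := fun ε => κ * F 1 * airyMoment (κ * τ) 1 +
        ε * (τ * F 1 * airyMoment (κ * τ) 0 -
          (κ ^ 2 * deriv F 1 + κ ^ 2 / 2 * F 1) * airyMoment (κ * τ) 2 +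
          τ * κ ^ 3 / 2 * F 1 * airyMoment (κ * τ) 3 -
          κ ^ 5 / 24 * F 1 * airyMoment (κ * τ) 5) with hJ
  set A : ℂ := -(1 / (2 * Real.pi * Complex.I * κ)) with hA
  have hcube : ∀ w : ℝ, 0 < w → (w ^ ((1 : ℝ) / 3)) ^ 3 = w := fun w hw => by
    rw [← Real.rpow_natCast, ← Real.rpow_mul hw.le]
    norm_num
  have hsq : ∀ w : ℝ, 0 < w → w ^ ((2 : ℝ) / 3) = (w ^ ((1 : ℝ) / 3)) ^ 2 := fun w hw => by
    rw [← Real.rpow_natCast, ← Real.rpow_mul hw.le]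
    norm_num
  have hsqrt : ∀ w : ℝ, 0 < w → w ^ ((1 : ℝ) / 6) = √(w ^ ((1 : ℝ) / 3)) := fun w hw => by
    rw [Real.sqrt_eq_rpow, ← Real.rpow_mul hw.le]
    norm_num
  have hsmall : ∀ᶠ w in 𝓝[>] (0 : ℝ), 0 < w ∧ w ^ ((1 : ℝ) / 3) ≤ 1 ∧ w ^ ((1 : ℝ) / 3) ≤ ε₀ := by
    have hpos : 0 < ε₀ := lt_min one_pos (by linarith)
    filter_upwards [Ioo_mem_nhdsGT (show (0 : ℝ) < ε₀ ^ 3 by positivity)] with w hw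
    have hle : w ^ ((1 : ℝ) / 3) ≤ ε₀ := by
      refine le_of_pow_le_pow_left₀ (n := 3) (by norm_num) hpos.le ?_
      rw [hcube w hw.1]
      exact hw.2.le
    exact ⟨hw.1, hle.trans (min_le_left _ _), hle⟩
  refine ⟨fun w => A * ((∫ s, rescaledIntegrand κ τ ω F (w ^ ((1 : ℝ) / 3)) s) -
    J (w ^ ((1 : ℝ) / 3))), ?_, ?_⟩
  · refine Asymptotics.IsBigO.of_bound (‖A‖ * C) ?_
    filter_upwards [hsmall] with w ⟨hw, h1, h2⟩
    have h := hC _ (Real.rpow_pos_of_pos hw _) h1 h2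
    rw [norm_mul, hsq w hw, mul_assoc, Real.norm_of_nonneg (by positivity)]
    gcongr
  · filter_upwards [hsmall] with w ⟨hw, h1, h2⟩
    rw [hκ_one, hκ_two, hκ_neg, hsq w hw, hsqrt w hw]
    have hε : 0 < w ^ ((1 : ℝ) / 3) := Real.rpow_pos_of_pos hw _
    have hwε := (hcube w hw).symm
    generalize w ^ ((1 : ℝ) / 3) = ε at *
    subst hwε
    have hεc : (ε : ℂ) ≠ 0 := by exact_mod_cast hε.ne'
    have hphi := phiR_one_mul_I_eq (wp := W (ε ^ 3)) hε hκ0 τ (ω := ω) (by simp [hωdef]) hF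
      (integrable_rescaledIntegrand hκ1 hκ2 hκ3 τ hK.le hω hF hε h1 h2)
    have hJeq : J ε = -(2 * Real.pi * Complex.I * κ) * (F 1 * airyAi' (κ * τ) +
        ε * (1 / 3 * (F 1 + 6 * deriv F 1) * (κ : ℂ)⁻¹ * τ * airyAi (κ * τ) +
          5 / 6 * F 1 * τ ^ 2 * airyAi' (κ * τ))) := by
      simp only [hJ]
      rw [airyMoment_coefficient_eq hκ3, airyAi'_eq_airyMoment]
      field_simp
      ring
    have hroot : √(2 * Real.pi * ε ^ 3) = √(2 * Real.pi) * (ε * √ε) := by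
      rw [Real.sqrt_mul (by positivity : (0 : ℝ) ≤ 2 * Real.pi), show ε ^ 3 = ε ^ 2 * ε by ring,
        Real.sqrt_mul (sq_nonneg ε), Real.sqrt_sq hε.le]
    have hr1 : ((√ε : ℝ) : ℂ) ^ 2 = ε := by exact_mod_cast Real.sq_sqrt hε.le
    have hr2 : ((√(2 * Real.pi) : ℝ) : ℂ) ^ 2 = 2 * Real.pi := by
      exact_mod_cast Real.sq_sqrt (by positivity : (0 : ℝ) ≤ 2 * Real.pi)
    have hr1' : ((√ε : ℝ) : ℂ) ≠ 0 := by exact_mod_cast (Real.sqrt_pos.2 hε).ne'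
    have hr2' : ((√(2 * Real.pi) : ℝ) : ℂ) ≠ 0 := by
      exact_mod_cast (Real.sqrt_pos.2 (by positivity : (0 : ℝ) < 2 * Real.pi)).ne'
    rw [hroot] at hphi
    refine mul_right_cancel₀ Complex.I_ne_zero ?_
    push_cast at hphi ⊢
    rw [hphi, hJeq, hA, ← hr2]
    generalize (∫ s, rescaledIntegrand κ τ ω F ε s) = S
    generalize Complex.exp (-1 / (2 * (ε : ℂ) ^ 3) + τ / ε) = P
    rw [← hr1]
    field_simp
    ring
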